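/- 2-log-Sobolev inequality for tensor products of qubit depolarizing generators (used with constant α = 2): Let n ≥ 1 and let L : M_{2^n} → M_{2^n} be the generator L = Σ_{k=1}^n L_k, where L_k(f) = f − (1/4) Σ_{α=0}^{3} σ_k^α f σ_k^α and σ_k^α denotes the α-th Pauli matrix (σ⁰ = I, σ¹, σ², σ³) acting on the k-th qubit tensor factor and identity elsewhere. Then for every positive semidefinite f ∈ M_{2^n}, Ent(f²) ≤ 2 E_L(f, f). -/

import Mathlib

open Matrix
open scoped ComplexOrder

noncomputable section

/-- Apply a real function to a Hermitian matrix via the functional calculus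
(junk value `0` on non-Hermitian matrices). -/
def hermFC {ι : Type*} [Fintype ι] [DecidableEq ι] (φ : ℝ → ℝ)
    (f : Matrix ι ι ℂ) : Matrix ι ι ℂ :=
  if hf : f.IsHermitian then
    (hf.eigenvectorUnitary : Matrix ι ι ℂ) *
      Matrix.diagonal (fun i => (φ (hf.eigenvalues i) : ℂ)) *
      (star hf.eigenvectorUnitary : Matrix ι ι ℂ)
  else 0

/-- Real matrix powers of a Hermitian matrix, via the functional calculus on eigenvalues. -/
def mpow {ι : Type*} [Fintype ι] [DecidableEq ι] (f : Matrix ι ι ℂ) (a : ℝ) :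
    Matrix ι ι ℂ :=
  hermFC (fun x => x ^ a) f

/-- The normalized trace `τ(f) = Tr f / d` (real part). -/
def ntrace {ι : Type*} [Fintype ι] [DecidableEq ι] (f : Matrix ι ι ℂ) : ℝ :=
  (f.trace).re / (Fintype.card ι)

/-- Normalized Schatten p-'norm': `‖f‖_p = ((1/d) Tr |f|^p)^(1/p)` with `|f| = √(f† f)`. -/
def snorm {ι : Type*} [Fintype ι] [DecidableEq ι] (p : ℝ) (f : Matrix ι ι ℂ) : ℝ :=
  (ntrace (mpow (fᴴ * f) (p / 2))) ^ (1 / p)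

/-- The entropy `Ent(f) = τ(f ln f) − τ(f) ln τ(f)`. -/
def mEnt {ι : Type*} [Fintype ι] [DecidableEq ι] (f : Matrix ι ι ℂ) : ℝ :=
  ntrace (hermFC (fun x => x * Real.log x) f) - ntrace f * Real.log (ntrace f)

/-- The Dirichlet form `E_L(f,g) = τ(f L(g))`. -/
def dirichlet {ι : Type*} [Fintype ι] [DecidableEq ι]
    (L : Matrix ι ι ℂ → Matrix ι ι ℂ) (f g : Matrix ι ι ℂ) : ℝ :=
  ntrace (f * L g)

/-- Complete positivity: every matrix extension `id_m ⊗ T` maps PSD matrices to PSD matrices. -/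
def IsCompletelyPositive {ι : Type*} [Fintype ι] [DecidableEq ι]
    (T : Matrix ι ι ℂ → Matrix ι ι ℂ) : Prop :=
  ∀ (m : ℕ) (M : Matrix (Fin m × ι) (Fin m × ι) ℂ), M.PosSemidef →
    (Matrix.of fun p q : Fin m × ι =>
      T (Matrix.of fun i j : ι => M (p.1, i) (q.1, j)) p.2 q.2).PosSemidef

/-- A quantum channel: a linear, completely positive, trace-preserving map. -/
def IsQChannel {ι : Type*} [Fintype ι] [DecidableEq ι]
    (T : Matrix ι ι ℂ → Matrix ι ι ℂ) : Prop :=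
  IsLinearMap ℂ T ∧ IsCompletelyPositive T ∧ ∀ f, (T f).trace = f.trace

/-- Reversibility (detailed balance w.r.t. the trace): `τ(f T(g)) = τ(T(f) g)`. -/
def IsReversible {ι : Type*} [Fintype ι] [DecidableEq ι]
    (T : Matrix ι ι ℂ → Matrix ι ι ℂ) : Prop :=
  ∀ f g : Matrix ι ι ℂ, (f * T g).trace = (T f * g).trace

/-- Primitivity: iterates of `T` converge on every density matrix to a fixed
full-rank state independent of the input. -/
def IsPrimitive {ι : Type*} [Fintype ι] [DecidableEq ι]
    (T : Matrix ι ι ℂ → Matrix ι ι ℂ) : Prop :=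
  ∃ σ : Matrix ι ι ℂ, σ.PosDef ∧ σ.trace = 1 ∧
    ∀ ρ : Matrix ι ι ℂ, ρ.PosSemidef → ρ.trace = 1 →
      Filter.Tendsto (fun k => T^[k] ρ) Filter.atTop (nhds σ)

/-- The depolarizing channel with parameter `γ` applied to the `k`-th qubit of `n` qubits:
`D_γ(f) = γ f + (1−γ) (tr_k f) ⊗_k (I/2)`. -/
def depolAt {n : ℕ} (γ : ℝ) (k : Fin n)
    (f : Matrix (Fin n → Fin 2) (Fin n → Fin 2) ℂ) :
    Matrix (Fin n → Fin 2) (Fin n → Fin 2) ℂ :=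
  Matrix.of fun x y =>
    (γ : ℂ) * f x y +
      ((1 - γ : ℝ) : ℂ) *
        (if x k = y k then
          (1 / 2) * ∑ b : Fin 2, f (Function.update x k b) (Function.update y k b)
        else 0)

/-- The tensor power `D_γ^{⊗n}` of the qubit depolarizing channel, acting on `n` qubits. -/
def depolChannel {n : ℕ} (γ : ℝ)
    (f : Matrix (Fin n → Fin 2) (Fin n → Fin 2) ℂ) :
    Matrix (Fin n → Fin 2) (Fin n → Fin 2) ℂ :=
  (List.finRange n).foldl (fun g k => depolAt γ k g) f

/-- The semigroup element `e^{−tL}` applied to `f`, defined by its power series. -/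
def opExp {ι : Type*} [Fintype ι] [DecidableEq ι]
    (L : Matrix ι ι ℂ → Matrix ι ι ℂ) (t : ℝ) (f : Matrix ι ι ℂ) : Matrix ι ι ℂ :=
  ∑' k : ℕ, (((-t) ^ k / (Nat.factorial k) : ℝ) : ℂ) • L^[k] f

/-- The classical noise operator `T_γ` on functions on the boolean cube:
each bit is flipped independently with probability `(1−γ)/2`. -/
def noiseOp {n : ℕ} (γ : ℝ) (f : (Fin n → Fin 2) → ℝ) : (Fin n → Fin 2) → ℝ :=
  fun x => ∑ y : Fin n → Fin 2,
    (∏ i : Fin n, if y i = x i then (1 + γ) / 2 else (1 - γ) / 2) * f y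

/-- The normalized `ℓ_p` 'norm' `‖f‖_p = (2^{-n} Σ_x |f(x)|^p)^{1/p}` on the boolean cube. -/
def lpnorm {n : ℕ} (p : ℝ) (f : (Fin n → Fin 2) → ℝ) : ℝ :=
  ((∑ x : Fin n → Fin 2, |f x| ^ p) / 2 ^ n) ^ (1 / p)

end

/-- The four Pauli matrices `σ⁰ = I, σ¹, σ², σ³`. -/
noncomputable def pauli : Fin 4 → Matrix (Fin 2) (Fin 2) ℂ :=
  ![1, !![0, 1; 1, 0], !![0, -Complex.I; Complex.I, 0], !![1, 0; 0, -1]]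

/-- The Pauli matrix `σ^a` acting on the `k`-th qubit of `n` qubits (identity elsewhere). -/
noncomputable def pauliAt {n : ℕ} (k : Fin n) (a : Fin 4) :
    Matrix (Fin n → Fin 2) (Fin n → Fin 2) ℂ :=
  Matrix.of fun x y => if ∀ j, j ≠ k → x j = y j then pauli a (x k) (y k) else 0

lemma hasDerivAt_sq_mul_log_sq (x : ℝ) :
    HasDerivAt (fun x : ℝ => x ^ 2 * Real.log (x ^ 2)) (4 * (x * Real.log x) + 2 * x) x := by
  have hfun : (fun x : ℝ => x ^ 2 * Real.log (x ^ 2)) = fun x => x * (2 * (x * Real.log x)) := by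
    ext x
    rw [Real.log_pow]
    push_cast
    ring
  rw [hfun]
  rcases eq_or_ne x 0 with rfl | hx
  · rw [hasDerivAt_iff_tendsto_slope]
    have hc : Filter.Tendsto (fun x : ℝ => 2 * (x * Real.log x)) (nhdsWithin 0 {0}ᶜ) (nhds 0) := by
      have := (Real.continuous_mul_log.const_mul 2).tendsto 0
      simp only [zero_mul, mul_zero] at this
      exact this.mono_left nhdsWithin_le_nhds
    simp only [zero_mul, mul_zero, add_zero]
    refine hc.congr' ?_
    filter_upwards [self_mem_nhdsWithin] with y hy
    have hy : y ≠ 0 := hy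
    simp only [slope, vsub_eq_sub, sub_zero, zero_mul, smul_eq_mul]
    field_simp
  · have h := (hasDerivAt_id x).mul ((Real.hasDerivAt_mul_log hx).const_mul 2)
    refine h.congr_deriv ?_
    simp only [id]
    ring

/-- A logarithmic-mean type bound for the divided differences of `x ↦ x log |x|`. -/
lemma mul_log_sub_mul_sub_le (a b : ℝ) :
    (a * Real.log a - b * Real.log b) * (a - b) ≤
      (a - b) ^ 2 * (1 + Real.log ((a ^ 2 + b ^ 2) / 2) / 2) := by
  rcases eq_or_ne b 0 with rfl | hb
  · rcases eq_or_ne a 0 with rfl | ha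
    · simp
    · have h2 : Real.log 2 ≤ 1 := by linarith [Real.log_two_lt_d9]
      have : Real.log ((a ^ 2 + 0 ^ 2) / 2) = 2 * Real.log a - Real.log 2 := by
        rw [Real.log_div (by positivity) (by norm_num)]
        simp [Real.log_pow]
      rw [this]
      nlinarith [sq_nonneg a]
  · set F : ℝ → ℝ := fun a =>
      (a - b) * (1 + Real.log ((a ^ 2 + b ^ 2) / 2) / 2) - a * Real.log a + b * Real.log b with hF
    have hpos : ∀ x : ℝ, 0 < (x ^ 2 + b ^ 2) / 2 := fun x => by positivity
    have hcont : Continuous F := by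
      have h1 : Continuous fun x : ℝ => Real.log ((x ^ 2 + b ^ 2) / 2) :=
        Continuous.log (by fun_prop) fun x => (hpos x).ne'
      have h2 := Real.continuous_mul_log
      fun_prop
    have hder : ∀ x : ℝ, x ≠ 0 → HasDerivAt F
        (1 + Real.log ((x ^ 2 + b ^ 2) / 2) / 2 + (x - b) * (x / ((x ^ 2 + b ^ 2)))
          - (Real.log x + 1)) x := by
      intro x hx
      have h1 : HasDerivAt (fun x : ℝ => (x ^ 2 + b ^ 2) / 2) x x := by
        have := ((hasDerivAt_pow 2 x).add_const (b ^ 2)).div_const 2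
        refine this.congr_deriv ?_
        simp
      have h2 := ((h1.log (hpos x).ne').div_const 2).const_add 1
      have h3 := (((hasDerivAt_id x).sub_const b).mul h2).sub (Real.hasDerivAt_mul_log hx)
      refine (h3.add_const (b * Real.log b)).congr_deriv ?_
      simp only [id]
      have := (hpos x).ne'
      have h4 : x ^ 2 + b ^ 2 ≠ 0 := by positivity
      field_simp
    have hnn : ∀ x : ℝ, x ≠ 0 → 0 ≤ deriv F x := by
      intro x hx
      rw [(hder x hx).deriv]
      have h4 : 0 < x ^ 2 + b ^ 2 := by positivity
      have h5 : Real.log (x ^ 2 / ((x ^ 2 + b ^ 2) / 2)) ≤ x ^ 2 / ((x ^ 2 + b ^ 2) / 2) - 1 :=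
        Real.log_le_sub_one_of_pos (by positivity)
      rw [Real.log_div (by positivity) (by positivity), Real.log_pow] at h5
      have h6 : 1 + Real.log ((x ^ 2 + b ^ 2) / 2) / 2 + (x - b) * (x / (x ^ 2 + b ^ 2))
          - (Real.log x + 1) = (x - b) ^ 2 / (2 * (x ^ 2 + b ^ 2)) +
          (x ^ 2 / ((x ^ 2 + b ^ 2) / 2) - 1 -
            ((2 : ℕ) * Real.log x - Real.log ((x ^ 2 + b ^ 2) / 2))) / 2 := by
        push_cast
        field_simp
        ring
      rw [h6]
      have : 0 ≤ (x - b) ^ 2 / (2 * (x ^ 2 + b ^ 2)) := by positivity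
      linarith
    have hmono : Monotone F := by
      refine MonotoneOn.Iic_union_Ici (a := 0) ?_ ?_
      · refine monotoneOn_of_deriv_nonneg (convex_Iic 0) hcont.continuousOn ?_ ?_
        · intro x hx
          rw [interior_Iic] at hx
          exact (hder x (ne_of_lt hx)).differentiableAt.differentiableWithinAt
        · intro x hx
          rw [interior_Iic] at hx
          exact hnn x (ne_of_lt hx)
      · refine monotoneOn_of_deriv_nonneg (convex_Ici 0) hcont.continuousOn ?_ ?_
        · intro x hx
          rw [interior_Ici] at hx
          exact (hder x (ne_of_gt hx)).differentiableAt.differentiableWithinAt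
        · intro x hx
          rw [interior_Ici] at hx
          exact hnn x (ne_of_gt hx)
    have hFb : F b = 0 := by simp [hF]
    have key : 0 ≤ F a * (a - b) := by
      rcases le_total b a with h | h
      · have := hmono h
        exact mul_nonneg (by linarith) (by linarith)
      · have := hmono h
        exact mul_nonneg_of_nonpos_of_nonpos (by linarith) (by linarith)
    simp only [hF] at key
    nlinarith

/-- A one-sided quadratic Taylor bound for `x ↦ x² log x²`. -/
lemma sq_mul_log_sq_le_taylor {S : ℝ} {a x : ℝ} (ha : a ^ 2 ≤ S) (hx : x ^ 2 ≤ S) :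
    x ^ 2 * Real.log (x ^ 2) ≤ a ^ 2 * Real.log (a ^ 2) +
      (4 * (a * Real.log a) + 2 * a) * (x - a) + (3 + Real.log S) * (x - a) ^ 2 := by
  set F : ℝ → ℝ := fun x => a ^ 2 * Real.log (a ^ 2) +
      (4 * (a * Real.log a) + 2 * a) * (x - a) + (3 + Real.log S) * (x - a) ^ 2
      - x ^ 2 * Real.log (x ^ 2) with hF
  have hder : ∀ y, HasDerivAt F ((4 * (a * Real.log a) + 2 * a) +
      2 * (3 + Real.log S) * (y - a) - (4 * (y * Real.log y) + 2 * y)) y := by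
    intro y
    have h1 := ((hasDerivAt_id y).sub_const a)
    have h2 := (((h1.const_mul (4 * (a * Real.log a) + 2 * a)).const_add
      (a ^ 2 * Real.log (a ^ 2))).add ((h1.pow 2).const_mul (3 + Real.log S))).sub
      (hasDerivAt_sq_mul_log_sq y)
    refine h2.congr_deriv ?_
    simp
    ring
  have hcont : Continuous F := continuous_iff_continuousAt.2 fun y => (hder y).continuousAt
  have hsgn : ∀ y, y ^ 2 ≤ S → 0 ≤ ((4 * (a * Real.log a) + 2 * a) +
      2 * (3 + Real.log S) * (y - a) - (4 * (y * Real.log y) + 2 * y)) * (y - a) := by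
    intro y hy
    rcases eq_or_ne y a with rfl | hne
    · simp
    have h := mul_log_sub_mul_sub_le y a
    have hp : 0 < (y ^ 2 + a ^ 2) / 2 := by
      rcases eq_or_ne a 0 with rfl | h0 <;> positivity
    have hlog : Real.log ((y ^ 2 + a ^ 2) / 2) ≤ Real.log S :=
      Real.log_le_log hp (by linarith)
    nlinarith [mul_le_mul_of_nonneg_left hlog (sq_nonneg (y - a))]
  have hFa : F a = 0 := by simp [hF]
  have hmain : 0 ≤ F x := by
    rw [← hFa]
    rcases le_total a x with h | h
    · refine monotoneOn_of_deriv_nonneg (convex_Icc a x) hcont.continuousOn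
        (fun y _ => (hder y).differentiableAt.differentiableWithinAt) ?_
        (Set.left_mem_Icc.2 h) (Set.right_mem_Icc.2 h) h
      intro y hy
      rw [interior_Icc] at hy
      rw [(hder y).deriv]
      refine nonneg_of_mul_nonneg_left (hsgn y ?_) (sub_pos.2 hy.1)
      nlinarith [hy.1, hy.2, mul_nonneg (sub_nonneg.2 hy.1.le) (sub_nonneg.2 hy.2.le)]
    · refine antitoneOn_of_deriv_nonpos (convex_Icc x a) hcont.continuousOn
        (fun y _ => (hder y).differentiableAt.differentiableWithinAt) ?_
        (Set.left_mem_Icc.2 h) (Set.right_mem_Icc.2 h) h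
      intro y hy
      rw [interior_Icc] at hy
      rw [(hder y).deriv]
      refine nonpos_of_mul_nonneg_left (hsgn y ?_) (sub_neg.2 hy.2)
      nlinarith [hy.1, hy.2, mul_nonneg (sub_nonneg.2 hy.1.le) (sub_nonneg.2 hy.2.le)]
  simp only [hF] at hmain
  linarith

/-- Gibbs' variational inequality. -/
lemma sum_mul_log_le_gibbs {ι : Type*} [Fintype ι] (β ω : ι → ℝ) (hω : ∀ i, 0 < ω i)
    (hb : 0 < ∑ i, β i ^ 2) :
    ∑ i, β i ^ 2 * Real.log (ω i) ≤ ∑ i, β i ^ 2 * Real.log (β i ^ 2)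
      - (∑ i, β i ^ 2) * Real.log (∑ i, β i ^ 2)
      + (∑ i, β i ^ 2) * Real.log (∑ i, ω i) := by
  set b := ∑ i, β i ^ 2 with hbdef
  have hne : (Finset.univ : Finset ι).Nonempty := by
    by_contra h
    rw [Finset.not_nonempty_iff_eq_empty] at h
    simp [hbdef, h] at hb
  set Ω := ∑ i, ω i with hΩdef
  have hΩ : 0 < Ω := Finset.sum_pos (fun i _ => hω i) hne
  have hterm : ∀ i, β i ^ 2 * Real.log (ω i) ≤ β i ^ 2 * Real.log (β i ^ 2)
      - β i ^ 2 * Real.log b + β i ^ 2 * Real.log Ω + (ω i * (b / Ω) - β i ^ 2) := by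
    intro i
    rcases eq_or_ne (β i) 0 with h0 | h0
    · have := mul_pos (hω i) (div_pos hb hΩ)
      simp [h0]
      exact this.le
    · have h2 : 0 < β i ^ 2 := by positivity
      have h := Real.log_le_sub_one_of_pos (div_pos (mul_pos (hω i) hb) (mul_pos h2 hΩ))
      rw [Real.log_div (mul_pos (hω i) hb).ne' (mul_pos h2 hΩ).ne',
        Real.log_mul (hω i).ne' hb.ne', Real.log_mul h2.ne' hΩ.ne'] at h
      have h' := mul_le_mul_of_nonneg_left h h2.le
      have e : β i ^ 2 * (ω i * b / (β i ^ 2 * Ω) - 1) = ω i * (b / Ω) - β i ^ 2 := by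
        field_simp
      rw [e] at h'
      linarith
  refine (Finset.sum_le_sum fun i _ => hterm i).trans (le_of_eq ?_)
  simp only [Finset.sum_add_distrib, Finset.sum_sub_distrib, ← Finset.sum_mul]
  rw [← hbdef, ← hΩdef, mul_div_cancel₀ _ hΩ.ne']
  ring

/-- A function with one-sided second-order increments bounded by those of `κ t² / 2`. -/
lemma le_add_half_of_increment_le {ψ : ℝ → ℝ} {κ M : ℝ}
    (h : ∀ t δ : ℝ, 0 ≤ t → 0 ≤ δ → t + δ ≤ 1 → ψ (t + δ) ≤ ψ t + κ * t * δ + M * δ ^ 2) :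
    ψ 1 ≤ ψ 0 + κ / 2 := by
  have hN : ∀ N : ℕ, 0 < N → ψ 1 ≤ ψ 0 + κ / 2 + (M - κ / 2) * (N : ℝ)⁻¹ := by
    intro N hN
    have hN' : (0 : ℝ) < N := by exact_mod_cast hN
    have hk : ∀ k : ℕ, k ≤ N → ψ (k / N) ≤
        ψ 0 + κ * (k * (k - 1)) / 2 * (N : ℝ)⁻¹ ^ 2 + M * k * (N : ℝ)⁻¹ ^ 2 := by
      intro k
      induction k with
      | zero => simp
      | succ k ih =>
        intro hkN
        have hk1 : ((k : ℝ) + 1) ≤ N := by exact_mod_cast hkN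
        have h1 := h (k / N) (N : ℝ)⁻¹ (by positivity) (by positivity) (by
          rw [div_add' _ _ _ hN'.ne', inv_mul_cancel₀ hN'.ne']
          exact div_le_one_of_le₀ hk1 hN'.le)
        have h2 := ih (by omega)
        have e : ((k + 1 : ℕ) : ℝ) / N = k / N + (N : ℝ)⁻¹ := by
          push_cast
          field_simp
        rw [e]
        refine h1.trans ?_
        push_cast
        have e2 : κ * (k / N) * (N : ℝ)⁻¹ = κ * k * (N : ℝ)⁻¹ ^ 2 := by field_simp
        rw [e2]
        nlinarith
    have h3 := hk N le_rfl
    rw [div_self hN'.ne'] at h3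
    refine h3.trans (le_of_eq ?_)
    field_simp
    ring
  have hlim : Filter.Tendsto (fun N : ℕ => ψ 0 + κ / 2 + (M - κ / 2) * (N : ℝ)⁻¹)
      Filter.atTop (nhds (ψ 0 + κ / 2 + (M - κ / 2) * 0)) :=
    (tendsto_inv_atTop_nhds_zero_nat.const_mul _).const_add _
  rw [mul_zero, add_zero] at hlim
  refine ge_of_tendsto hlim ?_
  filter_upwards [Filter.eventually_gt_atTop 0] with N hN'
  exact hN N hN'

section
variable {ι : Type*} [Fintype ι]

/-- The squared Hilbert–Schmidt norm. -/
noncomputable def hsSq (A : Matrix ι ι ℂ) : ℝ := (Aᴴ * A).trace.re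

lemma hsSq_eq_sum (A : Matrix ι ι ℂ) : hsSq A = ∑ i, ∑ j, Complex.normSq (A i j) := by
  rw [hsSq, trace_mul_comm, trace, Complex.re_sum]
  refine Finset.sum_congr rfl fun i _ => ?_
  rw [diag_apply, mul_apply, Complex.re_sum]
  simp [Complex.mul_conj]

lemma hsSq_nonneg (A : Matrix ι ι ℂ) : 0 ≤ hsSq A := by
  rw [hsSq_eq_sum]
  exact Finset.sum_nonneg fun i _ => Finset.sum_nonneg fun j _ => Complex.normSq_nonneg _

lemma eq_zero_of_hsSq_eq_zero {A : Matrix ι ι ℂ} (h : hsSq A = 0) : A = 0 := by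
  rw [hsSq_eq_sum] at h
  have h0 := (Finset.sum_eq_zero_iff_of_nonneg
    (fun i _ => Finset.sum_nonneg fun j _ => Complex.normSq_nonneg (A i j))).1 h
  ext i j
  have h1 := (Finset.sum_eq_zero_iff_of_nonneg
    (fun j _ => Complex.normSq_nonneg (A i j))).1 (h0 i (Finset.mem_univ _))
  exact Complex.normSq_eq_zero.1 (h1 j (Finset.mem_univ _))

variable [DecidableEq ι]

/-- The sum of `φ` over the (real parts of the) eigenvalues of `M`, with multiplicity. -/
noncomputable def trFun (φ : ℝ → ℝ) (M : Matrix ι ι ℂ) : ℝ :=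
  (M.charpoly.roots.map fun z => φ z.re).sum

lemma trFun_conj_diagonal (φ : ℝ → ℝ) {U : Matrix ι ι ℂ} (hU : Uᴴ * U = 1) (c : ι → ℝ) :
    trFun φ (U * diagonal (fun i => (c i : ℂ)) * Uᴴ) = ∑ i, φ (c i) := by
  have h : (U * diagonal (fun i => (c i : ℂ)) * Uᴴ).charpoly =
      ∏ i, (Polynomial.X - Polynomial.C (c i : ℂ)) := by
    rw [mul_assoc, charpoly_mul_comm, mul_assoc, hU, mul_one, charpoly_diagonal]
  have h' : ∏ i, (Polynomial.X - Polynomial.C (c i : ℂ)) =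
      ((Finset.univ.val.map fun i => (c i : ℂ)).map fun z => Polynomial.X - Polynomial.C z).prod := by
    rw [Multiset.map_map]
    rfl
  rw [trFun, h, h', Polynomial.roots_multiset_prod_X_sub_C, Multiset.map_map]
  simp only [Function.comp_def, Complex.ofReal_re]
  rfl

lemma Matrix.IsHermitian.exists_conj_diagonal {C : Matrix ι ι ℂ} (hC : C.IsHermitian) :
    ∃ (U : Matrix ι ι ℂ) (c : ι → ℝ), Uᴴ * U = 1 ∧ U * Uᴴ = 1 ∧
      C = U * diagonal (fun i => (c i : ℂ)) * Uᴴ := by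
  refine ⟨hC.eigenvectorUnitary, hC.eigenvalues, ?_, ?_, ?_⟩
  · exact Unitary.coe_star_mul_self hC.eigenvectorUnitary
  · exact Unitary.coe_mul_star_self hC.eigenvectorUnitary
  · have := hC.spectral_theorem
    rw [Unitary.conjStarAlgAut_apply] at this
    exact this

lemma isHermitian_conj_diagonal (U : Matrix ι ι ℂ) (c : ι → ℝ) :
    (U * diagonal (fun i => (c i : ℂ)) * Uᴴ).IsHermitian := by
  refine isHermitian_mul_mul_conjTranspose U ?_
  rw [IsHermitian, diagonal_conjTranspose]
  congr 1
  ext i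
  simp

lemma trace_diagonal_mul_mul_diagonal_mul_conjTranspose (V : Matrix ι ι ℂ) (a b : ι → ℝ) :
    (diagonal (fun i => (a i : ℂ)) * V * diagonal (fun i => (b i : ℂ)) * Vᴴ).trace.re =
      ∑ i, ∑ j, a i * b j * Complex.normSq (V i j) := by
  rw [trace, Complex.re_sum]
  refine Finset.sum_congr rfl fun i _ => ?_
  rw [diag_apply, mul_apply, Complex.re_sum]
  refine Finset.sum_congr rfl fun j _ => ?_
  rw [mul_diagonal, diagonal_mul, conjTranspose_apply]
  have : (a i : ℂ) * V i j * (b j : ℂ) * star (V i j) =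
      ((a i * b j * Complex.normSq (V i j) : ℝ) : ℂ) := by
    push_cast
    rw [Complex.normSq_eq_conj_mul_self]
    simp only [RCLike.star_def]
    ring
  rw [this, Complex.ofReal_re]

lemma trace_conj_diagonal_mul_conj_diagonal (U U' : Matrix ι ι ℂ) (a b : ι → ℝ) :
    ((U * diagonal (fun i => (a i : ℂ)) * Uᴴ) *
      (U' * diagonal (fun i => (b i : ℂ)) * U'ᴴ)).trace.re =
      ∑ i, ∑ j, a i * b j * Complex.normSq ((Uᴴ * U') i j) := by
  rw [← trace_diagonal_mul_mul_diagonal_mul_conjTranspose]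
  have : (U * diagonal (fun i => (a i : ℂ)) * Uᴴ) *
      (U' * diagonal (fun i => (b i : ℂ)) * U'ᴴ) =
      U * (diagonal (fun i => (a i : ℂ)) * Uᴴ *
      (U' * diagonal (fun i => (b i : ℂ)) * U'ᴴ)) := by simp only [mul_assoc]
  rw [this, trace_mul_comm, conjTranspose_mul, conjTranspose_conjTranspose]
  simp only [mul_assoc]

lemma sum_normSq_row {V : Matrix ι ι ℂ} (hV : V * Vᴴ = 1) (i : ι) :
    ∑ j, Complex.normSq (V i j) = 1 := by
  have h := congrArg Complex.re (congrFun (congrFun hV i) i)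
  rw [mul_apply, Complex.re_sum] at h
  simpa [Complex.mul_conj] using h

lemma sum_normSq_col {V : Matrix ι ι ℂ} (hV : Vᴴ * V = 1) (j : ι) :
    ∑ i, Complex.normSq (V i j) = 1 := by
  have h := sum_normSq_row (V := Vᴴ) (by rwa [conjTranspose_conjTranspose]) j
  simpa [conjTranspose_apply] using h

lemma hsSq_conj_diagonal {U : Matrix ι ι ℂ} (hU : Uᴴ * U = 1) (c : ι → ℝ) :
    hsSq (U * diagonal (fun i => (c i : ℂ)) * Uᴴ) = ∑ i, c i ^ 2 := by
  rw [hsSq, (isHermitian_conj_diagonal U c).eq, trace_conj_diagonal_mul_conj_diagonal, hU]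
  refine Finset.sum_congr rfl fun i _ => ?_
  rw [Finset.sum_eq_single i]
  · simp [sq]
  · intro j _ hj
    simp [one_apply_ne' hj]
  · simp

lemma hsSq_mul_diagonal_mul {p q : Matrix ι ι ℂ} (hp : pᴴ * p = 1) (hq : qᴴ * q = 1)
    (β ξ : ι → ℝ) :
    ((p * diagonal (fun i => (β i : ℂ)) * qᴴ)ᴴ *
      (p * diagonal (fun i => (ξ i : ℂ)) * qᴴ)).trace.re = ∑ k, β k * ξ k := by
  have : (p * diagonal (fun i => (β i : ℂ)) * qᴴ)ᴴ *
      (p * diagonal (fun i => (ξ i : ℂ)) * qᴴ) =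
      q * (diagonal (fun i => ((β i * ξ i : ℝ) : ℂ)) * qᴴ) := by
    have e : (diagonal (fun i => (β i : ℂ)))ᴴ = diagonal (fun i => (β i : ℂ)) := by
      rw [diagonal_conjTranspose]; congr 1; ext i; simp
    rw [conjTranspose_mul, conjTranspose_mul, conjTranspose_conjTranspose, e]
    calc _ = q * (diagonal (fun i => (β i : ℂ)) * ((pᴴ * p) *
        diagonal (fun i => (ξ i : ℂ)) * qᴴ)) := by simp only [mul_assoc]
      _ = _ := by
        rw [hp, one_mul, ← mul_assoc (diagonal _), diagonal_mul_diagonal]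
        simp
  rw [this, trace_mul_comm, mul_assoc, hq, mul_one, trace_diagonal, Complex.re_sum]
  simp

lemma sum_row_normSq_mul_diagonal_mul {p q : Matrix ι ι ℂ} (hq : qᴴ * q = 1) (ξ : ι → ℝ) (i : ι) :
    ∑ j, Complex.normSq ((p * diagonal (fun i => (ξ i : ℂ)) * qᴴ) i j) =
      ∑ k, ξ k ^ 2 * Complex.normSq (p i k) := by
  set X := p * diagonal (fun i => (ξ i : ℂ)) * qᴴ with hX
  have h1 : X * Xᴴ = p * diagonal (fun i => ((ξ i ^ 2 : ℝ) : ℂ)) * pᴴ := by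
    have e : (diagonal (fun i => (ξ i : ℂ)))ᴴ = diagonal (fun i => (ξ i : ℂ)) := by
      rw [diagonal_conjTranspose]; congr 1; ext i; simp
    rw [hX, conjTranspose_mul, conjTranspose_mul, conjTranspose_conjTranspose, e]
    calc _ = p * (diagonal (fun i => (ξ i : ℂ)) * ((qᴴ * q) *
        diagonal (fun i => (ξ i : ℂ)))) * pᴴ := by simp only [mul_assoc]
      _ = _ := by
        rw [hq, one_mul, diagonal_mul_diagonal]
        simp [sq]
  have h2 := congrArg Complex.re (congrFun (congrFun h1 i) i)
  rw [mul_apply, mul_apply, Complex.re_sum, Complex.re_sum] at h2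
  have e1 : ∀ j, (X i j * Xᴴ j i).re = Complex.normSq (X i j) := fun j => by
    simp [conjTranspose_apply, Complex.mul_conj]
  have e2 : ∀ k, ((p * diagonal (fun i => ((ξ i ^ 2 : ℝ) : ℂ))) i k * pᴴ k i).re =
      ξ k ^ 2 * Complex.normSq (p i k) := fun k => by
    rw [mul_diagonal, conjTranspose_apply, mul_right_comm, RCLike.star_def, Complex.mul_conj,
      ← Complex.ofReal_mul, Complex.ofReal_re, mul_comm]
  simpa only [e1, e2] using h2

lemma sum_col_normSq_mul_diagonal_mul {p q : Matrix ι ι ℂ} (hp : pᴴ * p = 1) (ξ : ι → ℝ) (j : ι) :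
    ∑ i, Complex.normSq ((p * diagonal (fun i => (ξ i : ℂ)) * qᴴ) i j) =
      ∑ k, ξ k ^ 2 * Complex.normSq (q j k) := by
  rw [← sum_row_normSq_mul_diagonal_mul (p := q) (q := p) hp]
  refine Finset.sum_congr rfl fun i _ => ?_
  have e : (diagonal (fun i => (ξ i : ℂ)))ᴴ = diagonal (fun i => (ξ i : ℂ)) := by
    rw [diagonal_conjTranspose]; congr 1; ext i; simp
  have : q * diagonal (fun i => (ξ i : ℂ)) * pᴴ =
      (p * diagonal (fun i => (ξ i : ℂ)) * qᴴ)ᴴ := by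
    rw [conjTranspose_mul, conjTranspose_mul, conjTranspose_conjTranspose, e, mul_assoc]
  rw [this, conjTranspose_apply, RCLike.star_def, Complex.normSq_conj]

/-- Half the expectation of `w` in the `k`-th columns of `p` and of `q`. -/
noncomputable def colMean (p q : Matrix ι ι ℂ) (w : ι → ℝ) (k : ι) : ℝ :=
  (∑ i, w i * (Complex.normSq (p i k) + Complex.normSq (q i k))) / 2

lemma colMean_add_const {p q : Matrix ι ι ℂ} (hp : pᴴ * p = 1) (hq : qᴴ * q = 1)
    (w : ι → ℝ) (s : ℝ) (k : ι) :
    colMean p q (fun i => w i + s) k = colMean p q w k + s := by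
  simp only [colMean, add_mul, mul_add, Finset.sum_add_distrib, ← Finset.mul_sum]
  rw [sum_normSq_col hp, sum_normSq_col hq]
  ring

lemma colMean_pos {p q : Matrix ι ι ℂ} (hp : pᴴ * p = 1) {w : ι → ℝ} (hw : ∀ i, 0 < w i) (k : ι) :
    0 < colMean p q w k := by
  refine div_pos (Finset.sum_pos' (fun i _ => mul_nonneg (hw i).le
    (add_nonneg (Complex.normSq_nonneg _) (Complex.normSq_nonneg _))) ?_) two_pos
  by_contra! h
  have h1 := sum_normSq_col hp k
  rw [Finset.sum_eq_zero] at h1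
  · exact zero_ne_one h1
  · intro i hi
    have h2 := h i hi
    have h3 := nonpos_of_mul_nonpos_right h2 (hw i)
    have := Complex.normSq_nonneg (p i k)
    have := Complex.normSq_nonneg (q i k)
    linarith

lemma sum_colMean {p q : Matrix ι ι ℂ} (hp : p * pᴴ = 1) (hq : q * qᴴ = 1) (w : ι → ℝ) :
    ∑ k, colMean p q w k = ∑ i, w i := by
  simp only [colMean]
  rw [← Finset.sum_div, Finset.sum_comm]
  simp only [← Finset.mul_sum, Finset.sum_add_distrib]
  simp only [sum_normSq_row hp, sum_normSq_row hq]
  rw [← Finset.sum_mul]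
  ring

lemma sum_sq_div_colMean_le {p q : Matrix ι ι ℂ} (hp : pᴴ * p = 1) (hq : qᴴ * q = 1)
    (β : ι → ℝ) {w : ι → ℝ} (hw : ∀ i, 0 < w i) :
    ∑ k, β k ^ 2 / colMean p q w k ≤
      ∑ i, ∑ j, Complex.normSq ((p * diagonal (fun i => (β i : ℂ)) * qᴴ) i j) /
        ((w i + w j) / 2) := by
  set B := p * diagonal (fun i => (β i : ℂ)) * qᴴ with hB
  set ξ : ι → ℝ := fun k => β k / colMean p q w k with hξ
  set X := p * diagonal (fun i => (ξ i : ℂ)) * qᴴ with hX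
  have hω := fun k => colMean_pos (q := q) hp hw k
  have hpt : ∀ i j, 2 * (star (B i j) * X i j).re -
      (w i + w j) / 2 * Complex.normSq (X i j) ≤ Complex.normSq (B i j) / ((w i + w j) / 2) := by
    intro i j
    have hr : 0 < (w i + w j) / 2 := by linarith [hw i, hw j]
    set r := (w i + w j) / 2
    rw [le_div_iff₀ hr]
    have h := Complex.normSq_nonneg (B i j - r * X i j)
    simp only [Complex.normSq_apply, Complex.sub_re, Complex.sub_im, Complex.mul_re,
      Complex.mul_im, Complex.ofReal_re, Complex.ofReal_im, RCLike.star_def, Complex.conj_re,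
      Complex.conj_im] at h ⊢
    nlinarith
  refine le_trans (le_of_eq ?_) (Finset.sum_le_sum fun i _ => Finset.sum_le_sum fun j _ => hpt i j)
  have h1 : ∑ i, ∑ j, (star (B i j) * X i j).re = ∑ k, β k * ξ k := by
    rw [← hsSq_mul_diagonal_mul hp hq, ← hB, ← hX, Finset.sum_comm, trace, Complex.re_sum]
    refine Finset.sum_congr rfl fun j _ => ?_
    rw [diag_apply, mul_apply, Complex.re_sum]
    simp only [conjTranspose_apply]
  have h2 : ∑ i, ∑ j, (w i + w j) / 2 * Complex.normSq (X i j) =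
      ∑ k, ξ k ^ 2 * colMean p q w k := by
    have e : ∀ i j, (w i + w j) / 2 * Complex.normSq (X i j) =
        w i / 2 * Complex.normSq (X i j) + w j / 2 * Complex.normSq (X i j) := fun i j => by ring
    simp only [e, Finset.sum_add_distrib]
    rw [Finset.sum_comm (f := fun i j => w j / 2 * Complex.normSq (X i j))]
    simp only [← Finset.mul_sum]
    simp only [hX, sum_row_normSq_mul_diagonal_mul hq, sum_col_normSq_mul_diagonal_mul hp]
    simp only [Finset.mul_sum, colMean, Finset.sum_div]
    rw [Finset.sum_comm, Finset.sum_comm (f := fun i k => w i / 2 * (ξ k ^ 2 *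
      Complex.normSq (q i k))), ← Finset.sum_add_distrib]
    refine Finset.sum_congr rfl fun k _ => ?_
    rw [← Finset.sum_add_distrib]
    refine Finset.sum_congr rfl fun i _ => ?_
    ring
  simp only [Finset.sum_sub_distrib, ← Finset.mul_sum]
  rw [h1, h2, Finset.mul_sum, ← Finset.sum_sub_distrib]
  refine Finset.sum_congr rfl fun k _ => ?_
  have := (hω k).ne'
  simp only [hξ]
  field_simp
  ring

/-- A form of Jensen's operator inequality for the logarithm. -/
lemma sum_normSq_mul_log_le {p q : Matrix ι ι ℂ} (hp : pᴴ * p = 1) (hq : qᴴ * q = 1)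
    (β : ι → ℝ) {w : ι → ℝ} (hw : ∀ i, 0 < w i) :
    ∑ i, ∑ j, Complex.normSq ((p * diagonal (fun i => (β i : ℂ)) * qᴴ) i j) *
        Real.log ((w i + w j) / 2) ≤ ∑ k, β k ^ 2 * Real.log (colMean p q w k) := by
  set B := p * diagonal (fun i => (β i : ℂ)) * qᴴ with hB
  set r : ι → ι → ℝ := fun i j => (w i + w j) / 2 with hr
  have hr0 : ∀ i j, 0 < r i j := fun i j => by
    have := hw i; have := hw j
    simp only [hr]; linarith
  have hω := fun k => colMean_pos (q := q) hp hw k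
  set G : ℝ → ℝ := fun s => ∑ i, ∑ j, Complex.normSq (B i j) * Real.log (r i j + s) -
    ∑ k, β k ^ 2 * Real.log (colMean p q w k + s) with hG
  have hmass : ∑ i, ∑ j, Complex.normSq (B i j) = ∑ k, β k ^ 2 := by
    have h := hsSq_mul_diagonal_mul hp hq β β
    rw [← hB] at h
    rw [← hsSq_eq_sum, hsSq, h]
    simp only [sq]
  have hlogder : ∀ c s : ℝ, 0 < c → 0 ≤ s → HasDerivAt (fun s => Real.log (c + s)) (1 / (c + s)) s :=
    fun c s hc hs => ((hasDerivAt_id s).const_add c).log (by simp only [id]; linarith)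
  have hder : ∀ s, 0 ≤ s → HasDerivAt G (∑ i, ∑ j, Complex.normSq (B i j) * (1 / (r i j + s)) -
      ∑ k, β k ^ 2 * (1 / (colMean p q w k + s))) s := by
    intro s hs
    refine HasDerivAt.sub ?_ ?_
    · refine HasDerivAt.fun_sum fun i _ => HasDerivAt.fun_sum fun j _ => ?_
      exact (hlogder _ s (hr0 i j) hs).const_mul _
    · refine HasDerivAt.fun_sum fun k _ => ?_
      exact (hlogder _ s (hω k) hs).const_mul _
  have hmono : MonotoneOn G (Set.Ici 0) := by
    refine monotoneOn_of_deriv_nonneg (convex_Ici 0)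
      (fun s hs => (hder s hs).continuousAt.continuousWithinAt) ?_ ?_
    · intro s hs
      rw [interior_Ici] at hs
      exact (hder s (le_of_lt hs)).differentiableAt.differentiableWithinAt
    · intro s hs
      rw [interior_Ici] at hs
      have hs' : 0 < s := hs
      rw [(hder s hs'.le).deriv, sub_nonneg]
      have h := sum_sq_div_colMean_le hp hq β (w := fun i => w i + s)
        (fun i => add_pos (hw i) hs')
      simp only [colMean_add_const hp hq, ← hB] at h
      have e : ∀ i j, (w i + s + (w j + s)) / 2 = r i j + s := fun i j => by
        simp only [hr]; ring
      simp only [e] at h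
      simpa only [mul_one_div] using h
  have hlog0 : ∀ c : ℝ, 0 < c → Filter.Tendsto (fun s => Real.log (c + s) - Real.log s)
      Filter.atTop (nhds 0) := by
    intro c hc
    have h1 : Filter.Tendsto (fun s : ℝ => c * s⁻¹ + 1) Filter.atTop (nhds (c * 0 + 1)) :=
      (tendsto_inv_atTop_zero.const_mul c).add_const 1
    rw [mul_zero, zero_add] at h1
    have h2 := h1.log one_ne_zero
    rw [Real.log_one] at h2
    refine h2.congr' ?_
    filter_upwards [Filter.eventually_gt_atTop 0] with s hs
    rw [← Real.log_div (by linarith) hs.ne']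
    congr 1
    field_simp
  have hlim : Filter.Tendsto G Filter.atTop (nhds 0) := by
    have h1 : Filter.Tendsto (fun s => ∑ i, ∑ j, Complex.normSq (B i j) *
        (Real.log (r i j + s) - Real.log s) -
        ∑ k, β k ^ 2 * (Real.log (colMean p q w k + s) - Real.log s)) Filter.atTop
        (nhds (∑ i, ∑ j, Complex.normSq (B i j) * 0 - ∑ k, β k ^ 2 * 0)) := by
      refine Filter.Tendsto.sub ?_ ?_
      · exact tendsto_finsetSum _ fun i _ => tendsto_finsetSum _ fun j _ =>
          (hlog0 _ (hr0 i j)).const_mul _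
      · exact tendsto_finsetSum _ fun k _ => (hlog0 _ (hω k)).const_mul _
    simp only [mul_zero, Finset.sum_const_zero, sub_zero] at h1
    refine h1.congr fun s => ?_
    simp only [hG, mul_sub, Finset.sum_sub_distrib, ← Finset.sum_mul]
    rw [hmass]
    ring
  have hfin : G 0 ≤ 0 := by
    refine ge_of_tendsto hlim ?_
    filter_upwards [Filter.eventually_ge_atTop 0] with s hs
    exact hmono (Set.mem_Ici.2 le_rfl) hs hs
  simp only [hG, add_zero] at hfin
  linarith

end

section
variable {ι : Type*} [Fintype ι]

lemma hsSq_sub {C C' : Matrix ι ι ℂ} (hC : C.IsHermitian) (hC' : C'.IsHermitian) :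
    hsSq (C' - C) = hsSq C' + hsSq C - 2 * (C * C').trace.re := by
  simp only [hsSq, conjTranspose_sub, hC.eq, hC'.eq, sub_mul, mul_sub, trace_sub, Complex.sub_re,
    trace_mul_comm C' C]
  ring

lemma hsSq_add {C C' : Matrix ι ι ℂ} (hC : C.IsHermitian) (hC' : C'.IsHermitian) :
    hsSq (C + C') = hsSq C + hsSq C' + 2 * (C * C').trace.re := by
  simp only [hsSq, conjTranspose_add, hC.eq, hC'.eq, add_mul, mul_add, trace_add, Complex.add_re,
    trace_mul_comm C' C]
  ring

lemma hsSq_smul (t : ℝ) (C : Matrix ι ι ℂ) : hsSq ((t : ℂ) • C) = t ^ 2 * hsSq C := by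
  rw [hsSq_eq_sum, hsSq_eq_sum, Finset.mul_sum]
  refine Finset.sum_congr rfl fun i _ => ?_
  rw [Finset.mul_sum]
  refine Finset.sum_congr rfl fun j _ => ?_
  rw [Matrix.smul_apply, smul_eq_mul, Complex.normSq_mul, Complex.normSq_ofReal, sq]

variable [DecidableEq ι]

lemma trace_conj_diagonal_mul_self {U : Matrix ι ι ℂ} (hU : Uᴴ * U = 1) (a b : ι → ℝ) :
    ((U * diagonal (fun i => (a i : ℂ)) * Uᴴ) *
      (U * diagonal (fun i => (b i : ℂ)) * Uᴴ)).trace.re = ∑ i, a i * b i := by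
  rw [trace_conj_diagonal_mul_conj_diagonal, hU]
  refine Finset.sum_congr rfl fun i _ => ?_
  rw [Finset.sum_eq_single i]
  · simp
  · intro j _ hj
    simp [one_apply_ne' hj]
  · simp

lemma commute_conj_diagonal {Z U : Matrix ι ι ℂ} (hU : Uᴴ * U = 1) (hU' : U * Uᴴ = 1)
    {c d : ι → ℝ} (hcd : ∀ i j, c i = c j → d i = d j)
    (h : Z * (U * diagonal (fun i => (c i : ℂ)) * Uᴴ) =
      U * diagonal (fun i => (c i : ℂ)) * Uᴴ * Z) :
    Z * (U * diagonal (fun i => (d i : ℂ)) * Uᴴ) =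
      U * diagonal (fun i => (d i : ℂ)) * Uᴴ * Z := by
  set W := Uᴴ * Z * U with hW
  have key : ∀ e : ι → ℝ, Uᴴ * (Z * (U * diagonal (fun i => (e i : ℂ)) * Uᴴ)) * U =
      W * diagonal (fun i => (e i : ℂ)) := fun e => by
    calc _ = Uᴴ * Z * U * diagonal (fun i => (e i : ℂ)) * (Uᴴ * U) := by simp only [mul_assoc]
      _ = _ := by rw [hU, mul_one]
  have key' : ∀ e : ι → ℝ, Uᴴ * (U * diagonal (fun i => (e i : ℂ)) * Uᴴ * Z) * U =
      diagonal (fun i => (e i : ℂ)) * W := fun e => by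
    calc _ = (Uᴴ * U) * diagonal (fun i => (e i : ℂ)) * (Uᴴ * Z * U) := by simp only [mul_assoc]
      _ = _ := by rw [hU, one_mul]
  have h1 : W * diagonal (fun i => (c i : ℂ)) = diagonal (fun i => (c i : ℂ)) * W := by
    rw [← key, ← key', h]
  have h2 : W * diagonal (fun i => (d i : ℂ)) = diagonal (fun i => (d i : ℂ)) * W := by
    ext i j
    have h3 := congrFun (congrFun h1 i) j
    rw [mul_diagonal, diagonal_mul] at h3 ⊢
    by_cases hij : c i = c j
    · rw [hcd i j hij, mul_comm]
    · have : W i j = 0 := by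
        have h4 : W i j * ((c j : ℂ) - c i) = 0 := by linear_combination h3
        rcases mul_eq_zero.1 h4 with h5 | h5
        · exact h5
        · exact absurd (Complex.ofReal_injective (sub_eq_zero.1 h5)).symm hij
      rw [this]
      ring
  rw [← key, ← key'] at h2
  have h3 := congrArg (fun M => U * M * Uᴴ) h2
  have e : ∀ M : Matrix ι ι ℂ, U * (Uᴴ * M * U) * Uᴴ = M := fun M => by
    calc _ = (U * Uᴴ) * M * (U * Uᴴ) := by simp only [mul_assoc]
      _ = M := by rw [hU', one_mul, mul_one]
  simpa only [e] using h3

/-- A one-sided quadratic Taylor bound for `C ↦ Tr (C² log C²)`. -/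
lemma sum_sq_mul_log_sq_le_taylor {U U' : Matrix ι ι ℂ} (hU : Uᴴ * U = 1) (hU' : U'ᴴ * U' = 1)
    (hU1 : U * Uᴴ = 1) (hU'1 : U' * U'ᴴ = 1) {c c' : ι → ℝ} {S : ℝ}
    (hc : ∀ i, c i ^ 2 ≤ S) (hc' : ∀ i, c' i ^ 2 ≤ S) :
    ∑ i, c' i ^ 2 * Real.log (c' i ^ 2) ≤ ∑ i, c i ^ 2 * Real.log (c i ^ 2) +
      ((U * diagonal (fun i => ((4 * (c i * Real.log (c i)) + 2 * c i : ℝ) : ℂ)) * Uᴴ) *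
        (U' * diagonal (fun i => (c' i : ℂ)) * U'ᴴ - U * diagonal (fun i => (c i : ℂ)) * Uᴴ)).trace.re
      + (3 + Real.log S) * hsSq
        (U' * diagonal (fun i => (c' i : ℂ)) * U'ᴴ - U * diagonal (fun i => (c i : ℂ)) * Uᴴ) := by
  rw [hsSq_sub (isHermitian_conj_diagonal U c) (isHermitian_conj_diagonal U' c'),
    hsSq_conj_diagonal hU, hsSq_conj_diagonal hU', trace_conj_diagonal_mul_conj_diagonal,
    mul_sub, trace_sub, Complex.sub_re, trace_conj_diagonal_mul_conj_diagonal,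
    trace_conj_diagonal_mul_self hU]
  set V := Uᴴ * U' with hV
  have hV1 : V * Vᴴ = 1 := by
    rw [hV, conjTranspose_mul, conjTranspose_conjTranspose]
    calc _ = Uᴴ * (U' * U'ᴴ) * U := by simp only [mul_assoc]
      _ = 1 := by rw [hU'1, mul_one, hU]
  have hV2 : Vᴴ * V = 1 := by
    rw [hV, conjTranspose_mul, conjTranspose_conjTranspose]
    calc _ = U'ᴴ * (U * Uᴴ) * U' := by simp only [mul_assoc]
      _ = 1 := by rw [hU1, mul_one, hU']
  have hrow : ∀ a : ι → ℝ, ∑ i, ∑ j, a i * Complex.normSq (V i j) = ∑ i, a i := fun a => by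
    simp only [← Finset.mul_sum, sum_normSq_row hV1, mul_one]
  have hcol : ∀ a : ι → ℝ, ∑ i, ∑ j, a j * Complex.normSq (V i j) = ∑ i, a i := fun a => by
    rw [Finset.sum_comm]
    simp only [← Finset.mul_sum, sum_normSq_col hV2, mul_one]
  have hpt : ∀ i j, c' j ^ 2 * Real.log (c' j ^ 2) * Complex.normSq (V i j) ≤
      c i ^ 2 * Real.log (c i ^ 2) * Complex.normSq (V i j) +
      ((4 * (c i * Real.log (c i)) + 2 * c i) * c' j * Complex.normSq (V i j) -
        (4 * (c i * Real.log (c i)) + 2 * c i) * c i * Complex.normSq (V i j)) +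
      (3 + Real.log S) * (c' j ^ 2 * Complex.normSq (V i j) + c i ^ 2 * Complex.normSq (V i j) -
        2 * (c i * c' j * Complex.normSq (V i j))) := by
    intro i j
    have h := mul_le_mul_of_nonneg_right (sq_mul_log_sq_le_taylor (hc i) (hc' j))
      (Complex.normSq_nonneg (V i j))
    linarith
  have hsum := Finset.sum_le_sum fun i (_ : i ∈ Finset.univ) =>
    Finset.sum_le_sum fun j (_ : j ∈ Finset.univ) => hpt i j
  simp only [Finset.sum_add_distrib, Finset.sum_sub_distrib, ← Finset.mul_sum (a := 3 + Real.log S),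
    ← Finset.mul_sum (a := (2 : ℝ))] at hsum
  rw [hcol (fun j => c' j ^ 2 * Real.log (c' j ^ 2)), hcol (fun j => c' j ^ 2),
    hrow (fun i => c i ^ 2 * Real.log (c i ^ 2)), hrow (fun i => c i ^ 2),
    hrow (fun i => (4 * (c i * Real.log (c i)) + 2 * c i) * c i)] at hsum
  exact hsum

set_option maxHeartbeats 1000000 in
lemma trace_mul_log_mul_le {Z C O U V : Matrix ι ι ℂ} {c β : ι → ℝ} {t : ℝ}
    (hZ : Zᴴ = Z) (hZZ : Z * Z = 1) (hU : Uᴴ * U = 1) (hU' : U * Uᴴ = 1)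
    (hV : Vᴴ * V = 1) (hV' : V * Vᴴ = 1) (hC : C = U * diagonal (fun i => (c i : ℂ)) * Uᴴ)
    (hO : O = V * diagonal (fun i => (β i : ℂ)) * Vᴴ) (ht : 0 < t)
    (hCO : C - Z * C * Z = ((2 * t : ℝ) : ℂ) • O)
    (hN : 0 < ∑ i, c i ^ 2) (hb : 0 < ∑ i, β i ^ 2) :
    ((U * diagonal (fun i => ((c i * Real.log (c i) : ℝ) : ℂ)) * Uᴴ) * O).trace.re ≤
      t * (∑ i, β i ^ 2 + (∑ i, β i ^ 2 * Real.log (β i ^ 2) -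
        (∑ i, β i ^ 2) * Real.log (∑ i, β i ^ 2) +
        (∑ i, β i ^ 2) * Real.log (∑ i, c i ^ 2)) / 2) := by
  set T := ((U * diagonal (fun i => ((c i * Real.log (c i) : ℝ) : ℂ)) * Uᴴ) * O).trace.re with hT
  set W := Uᴴ * (Z * U) with hW
  set p := Uᴴ * V with hp
  set q := Uᴴ * Z * V with hq
  set b := ∑ i, β i ^ 2 with hbdef
  have hWH : Wᴴ = W := by
    rw [hW, conjTranspose_mul, conjTranspose_mul, conjTranspose_conjTranspose, hZ, mul_assoc]
  have hWW : W * Wᴴ = 1 := by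
    rw [hWH, hW]
    calc _ = Uᴴ * (Z * (U * Uᴴ) * Z) * U := by simp only [mul_assoc]
      _ = 1 := by rw [hU', mul_one, hZZ, mul_one, hU]
  have hpp : pᴴ * p = 1 := by
    rw [hp, conjTranspose_mul, conjTranspose_conjTranspose]
    calc _ = Vᴴ * (U * Uᴴ) * V := by simp only [mul_assoc]
      _ = 1 := by rw [hU', mul_one, hV]
  have hpp' : p * pᴴ = 1 := by
    rw [hp, conjTranspose_mul, conjTranspose_conjTranspose]
    calc _ = Uᴴ * (V * Vᴴ) * U := by simp only [mul_assoc]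
      _ = 1 := by rw [hV', mul_one, hU]
  have hqq : qᴴ * q = 1 := by
    rw [hq, conjTranspose_mul, conjTranspose_mul, conjTranspose_conjTranspose, hZ]
    calc _ = Vᴴ * (Z * (U * Uᴴ) * Z) * V := by simp only [mul_assoc]
      _ = 1 := by rw [hU', mul_one, hZZ, mul_one, hV]
  have hqq' : q * qᴴ = 1 := by
    rw [hq, conjTranspose_mul, conjTranspose_mul, conjTranspose_conjTranspose, hZ]
    calc _ = Uᴴ * (Z * (V * Vᴴ) * Z) * U := by simp only [mul_assoc]
      _ = 1 := by rw [hV', mul_one, hZZ, mul_one, hU]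
  have hsymm : ∀ i j, Complex.normSq (W i j) = Complex.normSq (W j i) := by
    intro i j
    conv_lhs => rw [← hWH, conjTranspose_apply, RCLike.star_def, Complex.normSq_conj]
  set g : ι → ℝ := fun i => c i * Real.log (c i) with hg
  -- the trace as a double sum
  have h2t : 2 * t * T = ∑ i, g i * c i - ∑ i, ∑ j, g i * c j * Complex.normSq (W i j) := by
    have h1 : ((U * diagonal (fun i => (g i : ℂ)) * Uᴴ) * (C - Z * C * Z)).trace.re = 2 * t * T := by
      rw [hCO, mul_smul_comm, trace_smul, smul_eq_mul, Complex.re_ofReal_mul]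
    have h2 : Z * C * Z = (Z * U) * diagonal (fun i => (c i : ℂ)) * (Z * U)ᴴ := by
      rw [hC, conjTranspose_mul, hZ]
      simp only [mul_assoc]
    rw [← h1, mul_sub, trace_sub, Complex.sub_re, h2, trace_conj_diagonal_mul_conj_diagonal, ← hW,
      hC, trace_conj_diagonal_mul_self hU]
  have h4t : 4 * t * T =
      ∑ i, ∑ j, (g i - g j) * (c i - c j) * Complex.normSq (W i j) := by
    have e1 : ∑ i, ∑ j, g i * c i * Complex.normSq (W i j) = ∑ i, g i * c i := by
      simp only [← Finset.mul_sum, sum_normSq_row hWW, mul_one]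
    have e2 : ∑ i, ∑ j, g j * c j * Complex.normSq (W i j) = ∑ i, g i * c i := by
      rw [Finset.sum_comm, ← e1]
      exact Finset.sum_congr rfl fun i _ => Finset.sum_congr rfl fun j _ => by rw [hsymm]
    have e3 : ∑ i, ∑ j, g j * c i * Complex.normSq (W i j) =
        ∑ i, ∑ j, g i * c j * Complex.normSq (W i j) := by
      rw [Finset.sum_comm]
      exact Finset.sum_congr rfl fun i _ => Finset.sum_congr rfl fun j _ => by rw [hsymm]
    have e4 : ∀ i j, (g i - g j) * (c i - c j) * Complex.normSq (W i j) =
        g i * c i * Complex.normSq (W i j) - g i * c j * Complex.normSq (W i j) -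
        g j * c i * Complex.normSq (W i j) + g j * c j * Complex.normSq (W i j) :=
      fun i j => by ring
    simp only [e4, Finset.sum_add_distrib, Finset.sum_sub_distrib]
    rw [e1, e2, e3]
    linarith
  set B := p * diagonal (fun i => (β i : ℂ)) * qᴴ with hB
  have hBW : ∀ i j, (c i - c j) ^ 2 * Complex.normSq (W i j) =
      4 * t ^ 2 * Complex.normSq (B i j) := by
    have h1 : B = Uᴴ * O * Z * U := by
      rw [hB, hO, hp, hq, conjTranspose_mul, conjTranspose_mul, conjTranspose_conjTranspose, hZ]
      simp only [mul_assoc]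
    have h2 : ((2 * t : ℝ) : ℂ) • B = diagonal (fun i => (c i : ℂ)) * W -
        W * diagonal (fun i => (c i : ℂ)) := by
      have h3 : ((2 * t : ℝ) : ℂ) • B = Uᴴ * (((2 * t : ℝ) : ℂ) • O) * Z * U := by
        rw [h1]
        simp only [mul_smul_comm, smul_mul_assoc]
      rw [h3, ← hCO, hC, mul_sub, sub_mul, sub_mul]
      congr 1
      · calc _ = (Uᴴ * U) * diagonal (fun i => (c i : ℂ)) * (Uᴴ * (Z * U)) := by
              simp only [mul_assoc]
          _ = _ := by rw [hU, one_mul]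
      · calc _ = (Uᴴ * (Z * U)) * diagonal (fun i => (c i : ℂ)) * (Uᴴ * ((Z * Z) * U)) := by
              simp only [mul_assoc]
          _ = _ := by rw [hZZ, one_mul, hU, mul_one]
    intro i j
    have h3 := congrArg Complex.normSq (congrFun (congrFun h2 i) j)
    rw [Matrix.smul_apply, smul_eq_mul, Complex.normSq_mul, Complex.normSq_ofReal, Matrix.sub_apply,
      diagonal_mul, mul_diagonal, mul_comm (W i j), ← sub_mul, Complex.normSq_mul,
      ← Complex.ofReal_sub, Complex.normSq_ofReal] at h3
    linarith
  have hmass : ∑ i, ∑ j, Complex.normSq (B i j) = b := by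
    have h := hsSq_mul_diagonal_mul hpp hqq β β
    rw [← hB] at h
    rw [← hsSq_eq_sum, hsSq, h]
    simp only [hbdef, sq]
  have hε : ∀ ε : ℝ, 0 < ε → T ≤ t * (b + (∑ i, β i ^ 2 * Real.log (β i ^ 2) - b * Real.log b +
      b * Real.log (∑ i, c i ^ 2 + Fintype.card ι * ε)) / 2) := by
    intro ε hε
    set w : ι → ℝ := fun i => c i ^ 2 + ε with hw
    have hw0 : ∀ i, 0 < w i := fun i => by positivity
    have hpt : ∀ i j, (g i - g j) * (c i - c j) * Complex.normSq (W i j) ≤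
        4 * t ^ 2 * (Complex.normSq (B i j) +
          Complex.normSq (B i j) * Real.log ((w i + w j) / 2) / 2) := by
      intro i j
      have h1 := mul_le_mul_of_nonneg_right (mul_log_sub_mul_sub_le (c i) (c j))
        (Complex.normSq_nonneg (W i j))
      rcases eq_or_ne (c i) (c j) with hij | hij
      · have h2 := hBW i j
        have h3 : Complex.normSq (B i j) = 0 := by
          rw [hij, sub_self] at h2
          have : 4 * t ^ 2 * Complex.normSq (B i j) = 0 := by rw [← h2]; ring
          exact (mul_eq_zero.1 this).resolve_left (by positivity)
        rw [hij, h3]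
        simp
      · have hlog : Real.log ((c i ^ 2 + c j ^ 2) / 2) ≤ Real.log ((w i + w j) / 2) := by
          refine Real.log_le_log ?_ ?_
          · rcases eq_or_ne (c i) 0 with h0 | h0
            · have : c j ≠ 0 := fun h => hij (h0.trans h.symm)
              positivity
            · positivity
          · simp only [hw]; linarith
        refine h1.trans ?_
        have h2 := hBW i j
        have h3 := mul_le_mul_of_nonneg_left hlog
          (mul_nonneg (sq_nonneg (c i - c j)) (Complex.normSq_nonneg (W i j)))
        rw [h2] at h3
        have h4 : (c i - c j) ^ 2 * (1 + Real.log ((c i ^ 2 + c j ^ 2) / 2) / 2) *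
            Complex.normSq (W i j) = (c i - c j) ^ 2 * Complex.normSq (W i j) *
            (1 + Real.log ((c i ^ 2 + c j ^ 2) / 2) / 2) := by ring
        rw [h4, h2]
        linarith
    have h1 : 4 * t * T ≤ 4 * t ^ 2 * (b + (∑ i, ∑ j, Complex.normSq (B i j) *
        Real.log ((w i + w j) / 2)) / 2) := by
      rw [h4t]
      refine (Finset.sum_le_sum fun i _ => Finset.sum_le_sum fun j _ => hpt i j).trans
        (le_of_eq ?_)
      simp only [← Finset.mul_sum, Finset.sum_add_distrib, ← Finset.sum_div, hmass]
    have h2 := sum_normSq_mul_log_le hpp hqq β hw0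
    have h3 := sum_mul_log_le_gibbs β (colMean p q w) (fun k => colMean_pos hpp hw0 k) hb
    rw [sum_colMean hpp' hqq'] at h3
    have h4 : ∑ i, w i = ∑ i, c i ^ 2 + Fintype.card ι * ε := by
      simp [hw, Finset.sum_add_distrib]
    rw [h4] at h3
    have h5 : T ≤ t * (b + (∑ i, ∑ j, Complex.normSq (B i j) *
        Real.log ((w i + w j) / 2)) / 2) := by
      refine le_of_mul_le_mul_left ?_ (show 0 < 4 * t by positivity)
      linarith
    refine h5.trans (mul_le_mul_of_nonneg_left ?_ ht.le)
    linarith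
  have hlim : Filter.Tendsto (fun ε : ℝ => t * (b + (∑ i, β i ^ 2 * Real.log (β i ^ 2) -
      b * Real.log b + b * Real.log (∑ i, c i ^ 2 + Fintype.card ι * ε)) / 2))
      (nhdsWithin 0 (Set.Ioi 0)) (nhds (t * (b + (∑ i, β i ^ 2 * Real.log (β i ^ 2) -
      b * Real.log b + b * Real.log (∑ i, c i ^ 2 + Fintype.card ι * (0 : ℝ))) / 2))) := by
    have hc : ContinuousAt (fun ε : ℝ => ∑ i, c i ^ 2 + Fintype.card ι * ε) 0 := by fun_prop
    have hl := hc.log (by simpa using hN.ne')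
    exact (((hl.const_mul b).const_add _).div_const 2 |>.const_add b |>.const_mul t).tendsto.mono_left
      nhdsWithin_le_nhds
  rw [mul_zero, add_zero] at hlim
  refine ge_of_tendsto hlim ?_
  filter_upwards [self_mem_nhdsWithin] with ε h
  exact hε ε h

end

section
variable {ι : Type*} [Fintype ι] [DecidableEq ι]

lemma isHermitian_ofReal_smul {κ : Type*} {O : Matrix κ κ ℂ} (hO : O.IsHermitian) (t : ℝ) :
    ((t : ℂ) • O).IsHermitian := by
  rw [Matrix.IsHermitian, conjTranspose_smul, hO.eq]
  simp

/-- The entropy functional `Tr (C² log C²) - Tr C² log (Tr C²)` of a Hermitian matrix `C`. -/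
noncomputable def hsEnt (C : Matrix ι ι ℂ) : ℝ :=
  trFun (fun x => x ^ 2 * Real.log (x ^ 2)) C - hsSq C * Real.log (hsSq C)

lemma trFun_zero (φ : ℝ → ℝ) (h : φ 0 = 0) : trFun φ (0 : Matrix ι ι ℂ) = 0 := by
  have h0 : (0 : Matrix ι ι ℂ) = 1 * diagonal (fun _ => ((0 : ℝ) : ℂ)) * (1 : Matrix ι ι ℂ)ᴴ := by
    simp
  rw [h0, trFun_conj_diagonal φ (by simp)]
  simp [h]

lemma hsSq_zero : hsSq (0 : Matrix ι ι ℂ) = 0 := by simp [hsSq]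

lemma hsEnt_zero : hsEnt (0 : Matrix ι ι ℂ) = 0 := by
  rw [hsEnt, trFun_zero _ (by simp), hsSq_zero]
  simp

lemma mul_log_ge_tangent {x y : ℝ} (hx : 0 < x) (hy : 0 < y) :
    x * Real.log x + (1 + Real.log x) * (y - x) ≤ y * Real.log y := by
  have h := mul_le_mul_of_nonneg_left (Real.log_le_sub_one_of_pos (div_pos hx hy)) hy.le
  rw [Real.log_div hx.ne' hy.ne', mul_sub, mul_sub, mul_div_cancel₀ _ hy.ne'] at h
  linarith

lemma trace_mul_eq_zero_of_conj {Z A O : Matrix ι ι ℂ} (hZZ : Z * Z = 1)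
    (hA : Z * A = A * Z) (hO : Z * O * Z = -O) : (A * O).trace = 0 := by
  have h1 : (A * (Z * O * Z)).trace = (A * O).trace := by
    calc _ = ((A * Z * O) * Z).trace := by simp only [mul_assoc]
      _ = (Z * (A * Z * O)).trace := trace_mul_comm _ _
      _ = ((Z * A) * Z * O).trace := by simp only [mul_assoc]
      _ = (A * (Z * Z) * O).trace := by rw [hA]; simp only [mul_assoc]
      _ = _ := by rw [hZZ, mul_one]
  rw [hO, mul_neg, trace_neg] at h1
  exact self_eq_neg.1 h1.symm

lemma hsEnt_add_smul_le {Z P O : Matrix ι ι ℂ} (hZ : Zᴴ = Z) (hZZ : Z * Z = 1)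
    (hP : P.IsHermitian) (hO : O.IsHermitian) (hZP : Z * P * Z = P) (hZO : Z * O * Z = -O)
    (ha : 0 < hsSq P) (hb : 0 < hsSq O) {t δ : ℝ} (ht : 0 ≤ t) (hδ : 0 ≤ δ) (htδ : t + δ ≤ 1) :
    hsEnt (P + ((t + δ : ℝ) : ℂ) • O) ≤ hsEnt (P + (t : ℂ) • O) +
      (4 * hsSq O + 2 * hsEnt O) * t * δ +
      hsSq O * (2 + Real.log (hsSq P + hsSq O) - Real.log (hsSq P)) * δ ^ 2 := by
  have hZP' : Z * P = P * Z := by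
    calc Z * P = Z * P * (Z * Z) := by rw [hZZ, mul_one]
      _ = (Z * P * Z) * Z := by simp only [mul_assoc]
      _ = _ := by rw [hZP]
  have hPO : (P * O).trace = 0 := trace_mul_eq_zero_of_conj hZZ hZP' hZO
  have hCH : ∀ s : ℝ, (P + (s : ℂ) • O).IsHermitian := fun s =>
    hP.add (isHermitian_ofReal_smul hO s)
  have hN : ∀ s : ℝ, hsSq (P + (s : ℂ) • O) = hsSq P + s ^ 2 * hsSq O := fun s => by
    rw [hsSq_add hP (isHermitian_ofReal_smul hO s), hsSq_smul, mul_smul_comm, trace_smul, hPO]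
    simp
  obtain ⟨U, c, hU, hU1, hC⟩ := (hCH t).exists_conj_diagonal
  obtain ⟨U', c', hU', hU'1, hC'⟩ := (hCH (t + δ)).exists_conj_diagonal
  obtain ⟨V, β, hV, hV1, hOV⟩ := hO.exists_conj_diagonal
  have hc2 : ∑ i, c i ^ 2 = hsSq P + t ^ 2 * hsSq O := by
    rw [← hN, hC, hsSq_conj_diagonal hU]
  have hc'2 : ∑ i, c' i ^ 2 = hsSq P + (t + δ) ^ 2 * hsSq O := by
    rw [← hN, hC', hsSq_conj_diagonal hU']
  have hβ2 : ∑ i, β i ^ 2 = hsSq O := by rw [hOV, hsSq_conj_diagonal hV]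
  have hS : ∀ i, c i ^ 2 ≤ hsSq P + hsSq O := fun i => by
    refine (Finset.single_le_sum (fun j _ => sq_nonneg (c j)) (Finset.mem_univ i)).trans ?_
    rw [hc2]
    have : t ^ 2 ≤ 1 := pow_le_one₀ ht (by linarith)
    nlinarith
  have hS' : ∀ i, c' i ^ 2 ≤ hsSq P + hsSq O := fun i => by
    refine (Finset.single_le_sum (fun j _ => sq_nonneg (c' j)) (Finset.mem_univ i)).trans ?_
    rw [hc'2]
    have : (t + δ) ^ 2 ≤ 1 := pow_le_one₀ (by linarith) htδ
    nlinarith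
  have hTay := sum_sq_mul_log_sq_le_taylor hU hU' hU1 hU'1 hS hS'
  have hdiff : U' * diagonal (fun i => (c' i : ℂ)) * U'ᴴ - U * diagonal (fun i => (c i : ℂ)) * Uᴴ =
      (δ : ℂ) • O := by
    rw [← hC, ← hC', add_sub_add_left_eq_sub, ← sub_smul]
    congr 1
    push_cast
    ring
  set G := U * diagonal (fun i => ((c i * Real.log (c i) : ℝ) : ℂ)) * Uᴴ with hG
  have hgrad : U * diagonal (fun i => ((4 * (c i * Real.log (c i)) + 2 * c i : ℝ) : ℂ)) * Uᴴ =
      (4 : ℂ) • G + (2 : ℂ) • (P + (t : ℂ) • O) := by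
    have h : diagonal (fun i => ((4 * (c i * Real.log (c i)) + 2 * c i : ℝ) : ℂ)) =
        (4 : ℂ) • diagonal (fun i => ((c i * Real.log (c i) : ℝ) : ℂ)) +
          (2 : ℂ) • diagonal (fun i => (c i : ℂ)) := by
      ext i j
      by_cases hij : i = j
      · subst hij
        simp
      · simp [hij]
    rw [hC, hG, h]
    simp only [mul_add, add_mul, mul_smul_comm, smul_mul_assoc]
  have hOO : (O * O).trace.re = hsSq O := by rw [hsSq, hO.eq]
  have hT : (G * O).trace.re ≤ t * (hsSq O + (hsEnt O +
      hsSq O * Real.log (hsSq P + t ^ 2 * hsSq O)) / 2) := by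
    have hE : hsEnt O = ∑ i, β i ^ 2 * Real.log (β i ^ 2) - hsSq O * Real.log (hsSq O) := by
      rw [hsEnt]
      congr 1
      conv_lhs => rw [hOV]
      exact trFun_conj_diagonal _ hV β
    rcases ht.eq_or_lt with rfl | ht0
    · have hcomm : Z * G = G * Z := by
        refine commute_conj_diagonal (c := c) hU hU1 (fun i j h => by rw [h]) ?_
        rw [← hC]
        simpa using hZP'
      rw [trace_mul_eq_zero_of_conj hZZ hcomm hZO]
      simp
    · have h := trace_mul_log_mul_le hZ hZZ hU hU1 hV hV1 hC hOV ht0 (by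
        rw [mul_add, add_mul, hZP, mul_smul_comm, smul_mul_assoc, hZO, smul_neg,
          add_sub_add_left_eq_sub, sub_neg_eq_add, ← add_smul]
        congr 1
        push_cast
        ring) (by rw [hc2]; positivity) (by rw [hβ2]; exact hb)
      rw [hβ2, hc2, ← hE] at h
      exact h
  rw [hdiff, hgrad, hsSq_smul, mul_smul_comm, trace_smul, smul_eq_mul, Complex.re_ofReal_mul,
    add_mul, trace_add, smul_mul_assoc, smul_mul_assoc, trace_smul, trace_smul, add_mul,
    smul_mul_assoc, trace_add, trace_smul, hPO, zero_add, smul_eq_mul, smul_eq_mul, smul_eq_mul,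
    Complex.add_re, show (4 : ℂ) = ((4 : ℝ) : ℂ) by norm_num,
    show (2 : ℂ) = ((2 : ℝ) : ℂ) by norm_num, Complex.re_ofReal_mul, Complex.re_ofReal_mul,
    Complex.re_ofReal_mul, hOO] at hTay
  have hE1 : hsEnt (P + (t : ℂ) • O) = ∑ i, c i ^ 2 * Real.log (c i ^ 2) -
      (hsSq P + t ^ 2 * hsSq O) * Real.log (hsSq P + t ^ 2 * hsSq O) := by
    rw [hsEnt, hN]
    conv_lhs => rw [hC]
    rw [trFun_conj_diagonal _ hU]
  have hE2 : hsEnt (P + ((t + δ : ℝ) : ℂ) • O) = ∑ i, c' i ^ 2 * Real.log (c' i ^ 2) -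
      (hsSq P + (t + δ) ^ 2 * hsSq O) * Real.log (hsSq P + (t + δ) ^ 2 * hsSq O) := by
    rw [hsEnt, hN]
    conv_lhs => rw [hC']
    rw [trFun_conj_diagonal _ hU']
  have hη := mul_log_ge_tangent (show 0 < hsSq P + t ^ 2 * hsSq O by positivity)
    (show 0 < hsSq P + (t + δ) ^ 2 * hsSq O by positivity)
  have hlog : Real.log (hsSq P) ≤ Real.log (hsSq P + t ^ 2 * hsSq O) :=
    Real.log_le_log ha (by nlinarith [sq_nonneg t])
  have h1 := mul_le_mul_of_nonneg_left hlog (show 0 ≤ hsSq O * δ ^ 2 by positivity)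
  have h2 := mul_le_mul_of_nonneg_left hT hδ
  rw [hE1, hE2]
  linarith

/-- The entropy functional under a pinching: if `P` commutes and `O` anticommutes with a
Hermitian involution, then the entropy of `P + O` exceeds the sum of the entropies by at most
`2 Tr O²`. -/
lemma hsEnt_add_le {Z P O : Matrix ι ι ℂ} (hZ : Zᴴ = Z) (hZZ : Z * Z = 1)
    (hP : P.IsHermitian) (hO : O.IsHermitian) (hZP : Z * P * Z = P) (hZO : Z * O * Z = -O) :
    hsEnt (P + O) ≤ hsEnt P + hsEnt O + 2 * hsSq O := by
  rcases (hsSq_nonneg O).eq_or_lt with hb | hb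
  · rw [eq_zero_of_hsSq_eq_zero hb.symm, add_zero, hsEnt_zero, hsSq_zero]
    simp
  rcases (hsSq_nonneg P).eq_or_lt with ha | ha
  · rw [eq_zero_of_hsSq_eq_zero ha.symm, zero_add, hsEnt_zero]
    linarith
  have h := le_add_half_of_increment_le (ψ := fun s : ℝ => hsEnt (P + (s : ℂ) • O))
    fun t δ ht hδ htδ => hsEnt_add_smul_le hZ hZZ hP hO hZP hZO ha hb ht hδ htδ
  simp only [Complex.ofReal_one, Complex.ofReal_zero, one_smul, zero_smul, add_zero] at h
  linarith

/-- The absolute value of a Hermitian matrix which anticommutes with a Hermitian involution. -/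
lemma exists_abs {Z O : Matrix ι ι ℂ} (hZZ : Z * Z = 1) (hO : O.IsHermitian)
    (hZO : Z * O * Z = -O) :
    ∃ Q R₁ R₂ : Matrix ι ι ℂ, Q.IsHermitian ∧ Q + O = R₁ * R₁ᴴ ∧ Q - O = R₂ * R₂ᴴ ∧
      Z * Q = Q * Z ∧ Q * Q = O * O ∧ ∀ φ : ℝ → ℝ, (∀ x, φ (-x) = φ x) → trFun φ Q = trFun φ O := by
  obtain ⟨U, β, hU, hU1, hOU⟩ := hO.exists_conj_diagonal
  have hmul : ∀ a b : ι → ℝ, (U * diagonal (fun i => (a i : ℂ)) * Uᴴ) *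
      (U * diagonal (fun i => (b i : ℂ)) * Uᴴ) =
      U * diagonal (fun i => ((a i * b i : ℝ) : ℂ)) * Uᴴ := fun a b => by
    calc _ = U * (diagonal (fun i => (a i : ℂ)) * (Uᴴ * U) * diagonal (fun i => (b i : ℂ))) * Uᴴ := by
          simp only [mul_assoc]
      _ = _ := by
          rw [hU, mul_one, diagonal_mul_diagonal]
          simp only [Complex.ofReal_mul]
  have hadd : ∀ a b : ι → ℝ, U * diagonal (fun i => (a i : ℂ)) * Uᴴ +
      U * diagonal (fun i => (b i : ℂ)) * Uᴴ =
      U * diagonal (fun i => ((a i + b i : ℝ) : ℂ)) * Uᴴ := fun a b => by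
    rw [← add_mul, ← mul_add, diagonal_add]
    simp only [Complex.ofReal_add]
  have hsub : ∀ a b : ι → ℝ, U * diagonal (fun i => (a i : ℂ)) * Uᴴ -
      U * diagonal (fun i => (b i : ℂ)) * Uᴴ =
      U * diagonal (fun i => ((a i - b i : ℝ) : ℂ)) * Uᴴ := fun a b => by
    rw [← sub_mul, ← mul_sub, diagonal_sub]
    simp only [Complex.ofReal_sub]
  have hroot : ∀ a : ι → ℝ, (∀ i, 0 ≤ a i) → ∃ R : Matrix ι ι ℂ,
      U * diagonal (fun i => (a i : ℂ)) * Uᴴ = R * Rᴴ := fun a ha => by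
    refine ⟨U * diagonal (fun i => (Real.sqrt (a i) : ℂ)) * Uᴴ, ?_⟩
    rw [(isHermitian_conj_diagonal U _).eq, hmul]
    simp only [Real.mul_self_sqrt (ha _)]
  obtain ⟨R₁, h₁⟩ := hroot (fun i => |β i| + β i) fun i => by linarith [neg_abs_le (β i)]
  obtain ⟨R₂, h₂⟩ := hroot (fun i => |β i| - β i) fun i => by linarith [le_abs_self (β i)]
  refine ⟨U * diagonal (fun i => ((|β i| : ℝ) : ℂ)) * Uᴴ, R₁, R₂, isHermitian_conj_diagonal U _,
    ?_, ?_, ?_, ?_, ?_⟩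
  · rw [hOU, hadd, h₁]
  · rw [hOU, hsub, h₂]
  · refine commute_conj_diagonal (c := fun i => β i * β i) hU hU1
      (fun i j h => abs_eq_abs.2 (mul_self_eq_mul_self_iff.1 h)) ?_
    rw [← hmul, ← hOU]
    have h1 : Z * O = -(O * Z) := by
      calc Z * O = Z * O * (Z * Z) := by rw [hZZ, mul_one]
        _ = (Z * O * Z) * Z := by simp only [mul_assoc]
        _ = _ := by rw [hZO, neg_mul]
    calc Z * (O * O) = (Z * O) * O := by rw [mul_assoc]
      _ = -(O * Z) * O := by rw [h1]
      _ = -(O * (Z * O)) := by rw [neg_mul, mul_assoc]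
      _ = O * O * Z := by rw [← mul_neg, h1, neg_neg, mul_assoc]
  · rw [hOU, hmul, hmul]
    simp only [abs_mul_abs_self]
  · intro φ hφ
    rw [hOU, trFun_conj_diagonal φ hU, trFun_conj_diagonal φ hU]
    refine Finset.sum_congr rfl fun i _ => ?_
    rcases abs_choice (β i) with h | h <;> rw [h]
    exact hφ _

end

section
variable {ι κ ν : Type*} [Fintype ι] [Fintype ν]

/-- The Dirichlet form of `∑ k, (id - 4⁻¹ ∑ a, σ k a · σ k a)` for the unnormalized trace. -/
noncomputable def pauliForm [Fintype κ] (σ : κ → Fin 4 → Matrix ν ν ℂ) (g : Matrix ν ν ℂ) : ℝ :=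
  ∑ k, (hsSq g - 1 / 4 * ∑ a, (gᴴ * σ k a * g * σ k a).trace.re)

lemma re_trace_parallelogram (S A B : Matrix ν ν ℂ) :
    ((A + B)ᴴ * S * (A + B) * S).trace.re + ((A - B)ᴴ * S * (A - B) * S).trace.re =
      2 * (Aᴴ * S * A * S).trace.re + 2 * (Bᴴ * S * B * S).trace.re := by
  simp only [conjTranspose_add, conjTranspose_sub, add_mul, sub_mul, mul_add, mul_sub, trace_add,
    trace_sub, Complex.add_re, Complex.sub_re]
  ring

lemma hsSq_parallelogram (A B : Matrix ν ν ℂ) :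
    hsSq (A + B) + hsSq (A - B) = 2 * hsSq A + 2 * hsSq B := by
  simp only [hsSq, conjTranspose_add, conjTranspose_sub, add_mul, sub_mul, mul_add, mul_sub,
    trace_add, trace_sub, Complex.add_re, Complex.sub_re]
  ring

lemma pauliForm_parallelogram [Fintype κ] (σ : κ → Fin 4 → Matrix ν ν ℂ) (A B : Matrix ν ν ℂ) :
    pauliForm σ (A + B) + pauliForm σ (A - B) = 2 * pauliForm σ A + 2 * pauliForm σ B := by
  simp only [pauliForm, Finset.mul_sum, ← Finset.sum_add_distrib]
  refine Finset.sum_congr rfl fun k _ => ?_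
  have h : ∑ a, ((A + B)ᴴ * σ k a * (A + B) * σ k a).trace.re +
      ∑ a, ((A - B)ᴴ * σ k a * (A - B) * σ k a).trace.re =
      2 * ∑ a, (Aᴴ * σ k a * A * σ k a).trace.re + 2 * ∑ a, (Bᴴ * σ k a * B * σ k a).trace.re := by
    simp only [Finset.mul_sum, ← Finset.sum_add_distrib, re_trace_parallelogram]
  have h' := hsSq_parallelogram A B
  simp only [← Finset.mul_sum]
  linarith

lemma hsSq_conjTranspose (A : Matrix ν ν ℂ) : hsSq Aᴴ = hsSq A := by
  rw [hsSq, hsSq, conjTranspose_conjTranspose, trace_mul_comm]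

lemma hsSq_neg (A : Matrix ν ν ℂ) : hsSq (-A) = hsSq A := by
  simp [hsSq]

lemma re_trace_mul_conj_nonneg {Q O R₁ R₂ S : Matrix ι ι ℂ} (h₁ : Q + O = R₁ * R₁ᴴ)
    (h₂ : Q - O = R₂ * R₂ᴴ) (hS : Sᴴ = S) :
    (O * S * O * S).trace.re ≤ (Q * S * Q * S).trace.re := by
  have h : 0 ≤ ((Q + O) * S * (Q - O) * S).trace.re := by
    rw [h₁, h₂]
    have e : (R₁ * R₁ᴴ * S * (R₂ * R₂ᴴ) * S).trace = ((R₁ᴴ * S * R₂) * (R₁ᴴ * S * R₂)ᴴ).trace := by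
      rw [conjTranspose_mul, conjTranspose_mul, conjTranspose_conjTranspose, hS]
      calc _ = (R₁ * (R₁ᴴ * S * R₂ * R₂ᴴ * S)).trace := by simp only [mul_assoc]
        _ = (R₁ᴴ * S * R₂ * R₂ᴴ * S * R₁).trace := trace_mul_comm _ _
        _ = _ := by simp only [mul_assoc]
    rw [e, trace_mul_comm]
    exact hsSq_nonneg _
  have hc : (O * S * Q * S).trace = (Q * S * O * S).trace := by
    calc _ = ((O * S) * (Q * S)).trace := by simp only [mul_assoc]
      _ = ((Q * S) * (O * S)).trace := trace_mul_comm _ _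
      _ = _ := by simp only [mul_assoc]
  simp only [add_mul, mul_sub, sub_mul, trace_add, trace_sub, Complex.add_re, Complex.sub_re, hc]
    at h
  linarith

lemma trace_fromBlocks_eq (A B C D : Matrix ν ν ℂ) :
    (fromBlocks A B C D).trace = A.trace + D.trace := by
  simp [trace, Fintype.sum_sum_type]

lemma hsSq_fromBlocks (A B C D : Matrix ν ν ℂ) :
    hsSq (fromBlocks A B C D) = hsSq A + hsSq B + hsSq C + hsSq D := by
  simp only [hsSq_eq_sum, Fintype.sum_sum_type, fromBlocks_apply₁₁, fromBlocks_apply₁₂,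
    fromBlocks_apply₂₁, fromBlocks_apply₂₂, Finset.sum_add_distrib]
  ring

variable [DecidableEq ν]

lemma trFun_fromBlocks (φ : ℝ → ℝ) (A D : Matrix ν ν ℂ) :
    trFun φ (fromBlocks A 0 0 D) = trFun φ A + trFun φ D := by
  rw [trFun, charpoly_fromBlocks_zero₁₂, Polynomial.roots_mul
    (mul_ne_zero A.charpoly_monic.ne_zero D.charpoly_monic.ne_zero), Multiset.map_add,
    Multiset.sum_add]
  rfl

lemma trFun_neg {φ : ℝ → ℝ} (hφ : ∀ x, φ (-x) = φ x) {A : Matrix ν ν ℂ} (hA : A.IsHermitian) :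
    trFun φ (-A) = trFun φ A := by
  obtain ⟨U, c, hU, -, h⟩ := hA.exists_conj_diagonal
  have h' : -A = U * diagonal (fun i => ((-c i : ℝ) : ℂ)) * Uᴴ := by
    rw [h, ← neg_mul, ← mul_neg, diagonal_neg]
    simp
  rw [h', h, trFun_conj_diagonal φ hU, trFun_conj_diagonal φ hU]
  exact Finset.sum_congr rfl fun i _ => hφ _

lemma two_mul_mul_log_two_mul (x : ℝ) :
    (2 * x) * Real.log (2 * x) = 2 * x * Real.log x + 2 * x * Real.log 2 := by
  rcases eq_or_ne x 0 with rfl | hx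
  · simp
  · rw [Real.log_mul two_ne_zero hx]
    ring

lemma hsEnt_fromBlocks_of_hsSq_eq {A D : Matrix ν ν ℂ} (h : hsSq D = hsSq A) :
    hsEnt (fromBlocks A 0 0 D) = hsEnt A + hsEnt D - 2 * hsSq A * Real.log 2 := by
  have h2 : hsSq (fromBlocks A 0 0 D) = 2 * hsSq A := by
    rw [hsSq_fromBlocks, hsSq_zero, h]
    ring
  rw [hsEnt, hsEnt, hsEnt, h2, two_mul_mul_log_two_mul, trFun_fromBlocks, h]
  ring

lemma hsEnt_neg {A : Matrix ν ν ℂ} (hA : A.IsHermitian) : hsEnt (-A) = hsEnt A := by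
  rw [hsEnt, hsEnt, hsSq_neg, trFun_neg (fun x => by simp) hA]

/-- The entropy of the off-diagonal part of a block matrix is controlled by its absolute value. -/
lemma exists_hsEnt_fromBlocks_offDiag_eq [Fintype κ] {σ : κ → Fin 4 → Matrix ν ν ℂ}
    (hσ : ∀ k a, (σ k a)ᴴ = σ k a) (Y : Matrix ν ν ℂ) :
    ∃ G H : Matrix ν ν ℂ, G.IsHermitian ∧ H.IsHermitian ∧ hsSq G = hsSq Y ∧ hsSq H = hsSq Y ∧
      hsEnt (fromBlocks 0 Y Yᴴ 0) = hsEnt G + hsEnt H - 2 * hsSq Y * Real.log 2 ∧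
      pauliForm σ G + pauliForm σ H ≤ pauliForm σ Y + pauliForm σ Yᴴ := by
  set O : Matrix (ν ⊕ ν) (ν ⊕ ν) ℂ := fromBlocks 0 Y Yᴴ 0 with hO
  set Z : Matrix (ν ⊕ ν) (ν ⊕ ν) ℂ := fromBlocks 1 0 0 (-1) with hZ
  have hOH : O.IsHermitian := by
    rw [Matrix.IsHermitian, hO, fromBlocks_conjTranspose]
    simp
  have hZZ : Z * Z = 1 := by
    rw [hZ, fromBlocks_multiply]
    simp
  have hZO : Z * O * Z = -O := by
    rw [hZ, hO, fromBlocks_multiply, fromBlocks_multiply, fromBlocks_neg]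
    simp
  obtain ⟨Q, R₁, R₂, hQH, h₁, h₂, hZQ, hQQ, htr⟩ := exists_abs hZZ hOH hZO
  obtain ⟨G, K, M, H, rfl⟩ : ∃ G K M H, Q = fromBlocks G K M H :=
    ⟨_, _, _, _, (fromBlocks_toBlocks Q).symm⟩
  rw [hZ, fromBlocks_multiply, fromBlocks_multiply] at hZQ
  obtain ⟨-, hK, hM, -⟩ := fromBlocks_inj.1 hZQ
  have hK0 : K = 0 := by
    simp only [one_mul, zero_mul, add_zero, mul_zero, mul_neg, mul_one, zero_add] at hK
    ext i j
    exact self_eq_neg.1 (congrFun (congrFun hK i) j)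
  have hM0 : M = 0 := by
    simp only [neg_mul, one_mul, zero_mul, add_zero, mul_zero, mul_one, zero_add] at hM
    ext i j
    exact self_eq_neg.1 (congrFun (congrFun hM.symm i) j)
  subst hK0 hM0
  rw [Matrix.IsHermitian, fromBlocks_conjTranspose] at hQH
  obtain ⟨hG, -, -, hH⟩ := fromBlocks_inj.1 hQH
  rw [hO, fromBlocks_multiply, fromBlocks_multiply] at hQQ
  obtain ⟨hGG, -, -, hHH⟩ := fromBlocks_inj.1 hQQ
  simp only [mul_zero, add_zero, zero_add] at hGG hHH
  have hsG : hsSq G = hsSq Y := by rw [← hsSq_conjTranspose Y, hsSq, hG, hGG, hsSq,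
    conjTranspose_conjTranspose]
  have hsH : hsSq H = hsSq Y := by rw [hsSq, hH, hHH, hsSq]
  refine ⟨G, H, hG, hH, hsG, hsH, ?_, ?_⟩
  · rw [← hsG, ← hsEnt_fromBlocks_of_hsSq_eq (hsH.trans hsG.symm), hsEnt, hsEnt,
      htr _ (fun x => by simp), hO]
    congr 2
    · simp only [hsSq_fromBlocks, hsSq_conjTranspose, hsSq_zero, hsG, hsH]
      ring
    · simp only [hsSq_fromBlocks, hsSq_conjTranspose, hsSq_zero, hsG, hsH]
      ring_nf
  · simp only [pauliForm, ← Finset.sum_add_distrib]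
    refine Finset.sum_le_sum fun k _ => ?_
    have h : ∑ a, (Yᴴ * σ k a * Y * σ k a).trace.re + ∑ a, (Yᴴᴴ * σ k a * Yᴴ * σ k a).trace.re ≤
        ∑ a, (Gᴴ * σ k a * G * σ k a).trace.re + ∑ a, (Hᴴ * σ k a * H * σ k a).trace.re := by
      simp only [← Finset.sum_add_distrib]
      refine Finset.sum_le_sum fun a _ => ?_
      have h := re_trace_mul_conj_nonneg (S := fromBlocks (σ k a) 0 0 (σ k a)) h₁ h₂
        (by rw [fromBlocks_conjTranspose, hσ]; simp)
      rw [hO] at h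
      simp only [fromBlocks_multiply, trace_fromBlocks_eq, mul_zero, zero_mul, add_zero, zero_add,
        Complex.add_re] at h
      rw [conjTranspose_conjTranspose, hG, hH]
      linarith
    rw [hsG, hsH, hsSq_conjTranspose]
    linarith

lemma hsEnt_fromBlocks_le [Fintype κ] {σ : κ → Fin 4 → Matrix ν ν ℂ}
    (hσ : ∀ k a, (σ k a)ᴴ = σ k a) {N : ℝ} (hN : 0 < N)
    (ih : ∀ g : Matrix ν ν ℂ, g.IsHermitian → hsEnt g + hsSq g * Real.log N ≤ 2 * pauliForm σ g)
    {X Y W : Matrix ν ν ℂ} (hX : X.IsHermitian) (hW : W.IsHermitian) :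
    hsEnt (fromBlocks X Y Yᴴ W) + hsSq (fromBlocks X Y Yᴴ W) * Real.log (2 * N) ≤
      2 * (pauliForm σ X + pauliForm σ W + pauliForm σ Y + pauliForm σ Yᴴ +
        (1 / 2 * hsSq (X - W) + 2 * hsSq Y)) := by
  obtain ⟨A, B, hA, hB, rfl, rfl⟩ : ∃ A B : Matrix ν ν ℂ, A.IsHermitian ∧ B.IsHermitian ∧
      X = A + B ∧ W = A - B := by
    refine ⟨((1 / 2 : ℝ) : ℂ) • (X + W), ((1 / 2 : ℝ) : ℂ) • (X - W),
      isHermitian_ofReal_smul (hX.add hW) _, isHermitian_ofReal_smul (hX.sub hW) _, ?_, ?_⟩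
    · rw [← smul_add, add_add_sub_cancel, ← two_smul ℂ X, smul_smul]
      norm_num
    · rw [← smul_sub, add_sub_sub_cancel, ← two_smul ℂ W, smul_smul]
      norm_num
  obtain ⟨G, H, hG, hH, hsG, hsH, hE, hD⟩ := exists_hsEnt_fromBlocks_offDiag_eq hσ Y
  have h1 : hsEnt (fromBlocks (A + B) Y Yᴴ (A - B)) ≤ hsEnt (fromBlocks (A + B) 0 0 (A - B)) +
      hsEnt (fromBlocks 0 Y Yᴴ 0) + 2 * hsSq (fromBlocks 0 Y Yᴴ 0) := by
    have h := hsEnt_add_le (Z := fromBlocks (1 : Matrix ν ν ℂ) 0 0 (-1))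
      (P := fromBlocks (A + B) 0 0 (A - B)) (O := fromBlocks 0 Y Yᴴ 0)
      (by rw [fromBlocks_conjTranspose]; simp) (by rw [fromBlocks_multiply]; simp)
      (by rw [Matrix.IsHermitian, fromBlocks_conjTranspose, hX.eq, hW.eq]; simp)
      (by rw [Matrix.IsHermitian, fromBlocks_conjTranspose]; simp)
      (by rw [fromBlocks_multiply, fromBlocks_multiply]; simp)
      (by rw [fromBlocks_multiply, fromBlocks_multiply, fromBlocks_neg]; simp)
    rwa [fromBlocks_add, add_zero, zero_add, zero_add, add_zero] at h
  have h2 : hsEnt (fromBlocks (A + B) 0 0 (A - B)) ≤ hsEnt (fromBlocks A 0 0 A) +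
      hsEnt (fromBlocks B 0 0 (-B)) + 2 * hsSq (fromBlocks B 0 0 (-B)) := by
    have h := hsEnt_add_le (Z := fromBlocks 0 (1 : Matrix ν ν ℂ) 1 0)
      (P := fromBlocks A 0 0 A) (O := fromBlocks B 0 0 (-B))
      (by rw [fromBlocks_conjTranspose]; simp) (by rw [fromBlocks_multiply]; simp)
      (by rw [Matrix.IsHermitian, fromBlocks_conjTranspose, hA.eq]; simp)
      (by rw [Matrix.IsHermitian, fromBlocks_conjTranspose, conjTranspose_neg, hB.eq]; simp)
      (by rw [fromBlocks_multiply, fromBlocks_multiply]; simp)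
      (by rw [fromBlocks_multiply, fromBlocks_multiply, fromBlocks_neg]; simp)
    rwa [fromBlocks_add, add_zero, ← sub_eq_add_neg] at h
  rw [hE] at h1
  rw [hsEnt_fromBlocks_of_hsSq_eq rfl, hsEnt_fromBlocks_of_hsSq_eq (hsSq_neg B), hsEnt_neg hB] at h2
  simp only [hsSq_fromBlocks, hsSq_zero, hsSq_neg, hsSq_conjTranspose, add_zero, zero_add] at h1 h2 ⊢
  have hBB : hsSq (A + B - (A - B)) = 4 * hsSq B := by
    have e : A + B - (A - B) = ((2 : ℝ) : ℂ) • B := by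
      rw [add_sub_sub_cancel, ← two_smul ℂ B]
      norm_num
    rw [e, hsSq_smul]
    norm_num
  rw [Real.log_mul two_ne_zero hN.ne', hBB]
  have hpar := hsSq_parallelogram A B
  have hpar' := pauliForm_parallelogram σ A B
  have iA := ih A hA
  have iB := ih B hB
  have iG := ih G hG
  have iH := ih H hH
  rw [hsG] at iG
  rw [hsH] at iH
  have e : hsSq (A + B) + hsSq Y + hsSq Y + hsSq (A - B) = 2 * hsSq A + 2 * hsSq B + 2 * hsSq Y := by
    linarith
  rw [e]
  linarith

end

section
variable {α β : Type*} [Fintype α] [Fintype β]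

lemma hsSq_submatrix_equiv (e : α ≃ β) (A : Matrix β β ℂ) : hsSq (A.submatrix e e) = hsSq A := by
  simp only [hsSq_eq_sum, submatrix_apply]
  rw [← e.sum_comp]
  exact Finset.sum_congr rfl fun i _ => e.sum_comp (fun j => Complex.normSq (A (e i) j))

lemma trace_submatrix_equiv_self (e : α ≃ β) (A : Matrix β β ℂ) :
    (A.submatrix e e).trace = A.trace :=
  e.sum_comp fun i => A i i

lemma pauliForm_submatrix_equiv {κ : Type*} [Fintype κ] (e : α ≃ β)
    (σ : κ → Fin 4 → Matrix β β ℂ) (A : Matrix β β ℂ) :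
    pauliForm (fun k a => (σ k a).submatrix e e) (A.submatrix e e) = pauliForm σ A := by
  simp only [pauliForm, hsSq_submatrix_equiv, conjTranspose_submatrix, submatrix_mul_equiv,
    trace_submatrix_equiv_self]

variable [DecidableEq α] [DecidableEq β]

lemma trFun_submatrix_equiv (φ : ℝ → ℝ) (e : α ≃ β) (A : Matrix β β ℂ) :
    trFun φ (A.submatrix e e) = trFun φ A := by
  have h := charpoly_reindex e.symm A
  rw [reindex_apply, Equiv.symm_symm] at h
  rw [trFun, trFun, h]

lemma hsEnt_submatrix_equiv (e : α ≃ β) (A : Matrix β β ℂ) :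
    hsEnt (A.submatrix e e) = hsEnt A := by
  rw [hsEnt, hsEnt, trFun_submatrix_equiv, hsSq_submatrix_equiv]

lemma re_trace_hermFC (φ : ℝ → ℝ) {A : Matrix α α ℂ} (hA : A.IsHermitian) :
    (hermFC φ A).trace.re = trFun φ A := by
  have hU : (hA.eigenvectorUnitary : Matrix α α ℂ)ᴴ * hA.eigenvectorUnitary = 1 :=
    Unitary.coe_star_mul_self hA.eigenvectorUnitary
  have h1 : A = (hA.eigenvectorUnitary : Matrix α α ℂ) *
      diagonal (fun i => (hA.eigenvalues i : ℂ)) * (hA.eigenvectorUnitary : Matrix α α ℂ)ᴴ := by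
    conv_lhs => rw [hA.spectral_theorem]
    rfl
  have h2 : trFun φ A = ∑ i, φ (hA.eigenvalues i) := by
    conv_lhs => rw [h1]
    exact trFun_conj_diagonal φ hU _
  rw [h2, hermFC, dif_pos hA, trace_mul_comm, ← mul_assoc]
  change ((hA.eigenvectorUnitary : Matrix α α ℂ)ᴴ * hA.eigenvectorUnitary * _).trace.re = _
  rw [hU, one_mul, trace_diagonal]
  simp

lemma trFun_mul_self (φ : ℝ → ℝ) {A : Matrix α α ℂ} (hA : A.IsHermitian) :
    trFun φ (A * A) = trFun (fun x => φ (x ^ 2)) A := by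
  obtain ⟨U, c, hU, -, h⟩ := hA.exists_conj_diagonal
  have h' : A * A = U * diagonal (fun i => ((c i ^ 2 : ℝ) : ℂ)) * Uᴴ := by
    rw [h]
    calc _ = U * (diagonal (fun i => (c i : ℂ)) * (Uᴴ * U) * diagonal (fun i => (c i : ℂ))) * Uᴴ := by
          simp only [mul_assoc]
      _ = _ := by
          rw [hU, mul_one, diagonal_mul_diagonal]
          simp only [sq, Complex.ofReal_mul]
  rw [h', trFun_conj_diagonal φ hU]
  conv_rhs => rw [h]
  rw [trFun_conj_diagonal _ hU]

end

lemma pauli_conjTranspose (a : Fin 4) : (pauli a)ᴴ = pauli a := by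
  ext i j
  fin_cases a <;> fin_cases i <;> fin_cases j <;> simp [pauli]

lemma pauliAt_conjTranspose {n : ℕ} (k : Fin n) (a : Fin 4) : (pauliAt k a)ᴴ = pauliAt k a := by
  ext x y
  have h : star (pauli a (y k) (x k)) = pauli a (x k) (y k) :=
    congrFun (congrFun (pauli_conjTranspose a) (x k)) (y k)
  simp only [pauliAt, conjTranspose_apply, of_apply, apply_ite star, star_zero, h, eq_comm]

/-- Splitting off the first qubit. -/
noncomputable def consSumEquiv (n : ℕ) :
    (Fin n → Fin 2) ⊕ (Fin n → Fin 2) ≃ (Fin (n + 1) → Fin 2) :=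
  Equiv.ofBijective (Sum.elim (fun x => Fin.cons (α := fun _ => Fin 2) 0 x)
    (fun x => Fin.cons (α := fun _ => Fin 2) 1 x)) (by
    constructor
    · rintro (x | x) (y | y) h <;> simp_all [Fin.cons_inj]
    · intro x
      have h := Fin.cons_self_tail x
      rcases Fin.exists_fin_two.1 ⟨x 0, rfl⟩ with h0 | h0 <;> rw [h0] at h
      · exact ⟨Sum.inl (Fin.tail x), h⟩
      · exact ⟨Sum.inr (Fin.tail x), h⟩)

@[simp] lemma consSumEquiv_inl {n : ℕ} (x : Fin n → Fin 2) :
    consSumEquiv n (Sum.inl x) = Fin.cons 0 x := rfl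

@[simp] lemma consSumEquiv_inr {n : ℕ} (x : Fin n → Fin 2) :
    consSumEquiv n (Sum.inr x) = Fin.cons 1 x := rfl

lemma pauliAt_cons_zero {n : ℕ} (a : Fin 4) (b c : Fin 2) (x y : Fin n → Fin 2) :
    pauliAt (n := n + 1) 0 a (Fin.cons b x) (Fin.cons c y) =
      pauli a b c * (1 : Matrix (Fin n → Fin 2) (Fin n → Fin 2) ℂ) x y := by
  simp [pauliAt, Fin.forall_fin_succ, one_apply, funext_iff]

lemma pauliAt_cons_succ {n : ℕ} (k : Fin n) (a : Fin 4) (b c : Fin 2) (x y : Fin n → Fin 2) :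
    pauliAt k.succ a (Fin.cons b x) (Fin.cons c y) = if b = c then pauliAt k a x y else 0 := by
  by_cases h : b = c <;>
    simp [pauliAt, Fin.forall_fin_succ, h, (Fin.succ_ne_zero k).symm]

lemma pauliAt_zero_submatrix {n : ℕ} (a : Fin 4) :
    (pauliAt (0 : Fin (n + 1)) a).submatrix (consSumEquiv n) (consSumEquiv n) =
      fromBlocks (pauli a 0 0 • 1) (pauli a 0 1 • 1) (pauli a 1 0 • 1) (pauli a 1 1 • 1) := by
  ext (x | x) (y | y) <;> simp [pauliAt_cons_zero]

lemma pauliAt_succ_submatrix {n : ℕ} (k : Fin n) (a : Fin 4) :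
    (pauliAt k.succ a).submatrix (consSumEquiv n) (consSumEquiv n) =
      fromBlocks (pauliAt k a) 0 0 (pauliAt k a) := by
  ext (x | x) (y | y) <;> simp [pauliAt_cons_succ]

lemma pauliForm_fromBlocks {n : ℕ} (X Y Y' W : Matrix (Fin n → Fin 2) (Fin n → Fin 2) ℂ) :
    pauliForm (fun (k : Fin (n + 1)) a =>
      (pauliAt k a).submatrix (consSumEquiv n) (consSumEquiv n)) (fromBlocks X Y Y' W) =
      pauliForm (κ := Fin n) pauliAt X + pauliForm (κ := Fin n) pauliAt W +
      pauliForm (κ := Fin n) pauliAt Y + pauliForm (κ := Fin n) pauliAt Y' +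
      (1 / 2 * hsSq (X - W) + hsSq Y + hsSq Y') := by
  have hsucc : ∀ k : Fin n, ∀ a, ((fromBlocks X Y Y' W)ᴴ *
      (pauliAt k.succ a).submatrix (consSumEquiv n) (consSumEquiv n) * (fromBlocks X Y Y' W) *
      (pauliAt k.succ a).submatrix (consSumEquiv n) (consSumEquiv n)).trace.re =
      (Xᴴ * pauliAt k a * X * pauliAt k a).trace.re + (Wᴴ * pauliAt k a * W * pauliAt k a).trace.re +
      (Yᴴ * pauliAt k a * Y * pauliAt k a).trace.re +
      (Y'ᴴ * pauliAt k a * Y' * pauliAt k a).trace.re := fun k a => by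
    rw [pauliAt_succ_submatrix, fromBlocks_conjTranspose]
    simp only [fromBlocks_multiply, trace_fromBlocks_eq, mul_zero, add_zero, zero_add,
      add_mul, trace_add, Complex.add_re]
    ring
  have hzero : ∑ a, ((fromBlocks X Y Y' W)ᴴ *
      (pauliAt 0 a).submatrix (consSumEquiv n) (consSumEquiv n) * (fromBlocks X Y Y' W) *
      (pauliAt 0 a).submatrix (consSumEquiv n) (consSumEquiv n)).trace.re = 2 * hsSq (X + W) := by
    have h : ∀ a, ((pauliAt 0 a).submatrix (consSumEquiv n) (consSumEquiv n) *
        (fromBlocks X Y Y' W) * (pauliAt 0 a).submatrix (consSumEquiv n) (consSumEquiv n)) =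
        ![fromBlocks X Y Y' W, fromBlocks W Y' Y X, fromBlocks W (-Y') (-Y) X,
          fromBlocks X (-Y) (-Y') W] a := fun a => by
      rw [pauliAt_zero_submatrix, fromBlocks_multiply, fromBlocks_multiply]
      fin_cases a <;> simp [pauli, smul_smul]
    have h' : ∀ a, (fromBlocks X Y Y' W)ᴴ *
      (pauliAt 0 a).submatrix (consSumEquiv n) (consSumEquiv n) * (fromBlocks X Y Y' W) *
      (pauliAt 0 a).submatrix (consSumEquiv n) (consSumEquiv n) = (fromBlocks X Y Y' W)ᴴ *
        ![fromBlocks X Y Y' W, fromBlocks W Y' Y X, fromBlocks W (-Y') (-Y) X,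
          fromBlocks X (-Y) (-Y') W] a := fun a => by
      rw [← h]
      simp only [mul_assoc]
    simp only [h', Fin.sum_univ_four]
    simp [fromBlocks_conjTranspose, fromBlocks_multiply, trace_fromBlocks_eq, hsSq, mul_add, add_mul]
    ring
  rw [pauliForm, Fin.sum_univ_succ, hzero]
  simp only [hsucc, hsSq_fromBlocks, pauliForm, ← Finset.sum_add_distrib]
  have hpar := hsSq_parallelogram X W
  rw [add_comm]
  congr 1
  · refine Finset.sum_congr rfl fun k _ => ?_
    simp only [Finset.sum_add_distrib]
    ring
  · linarith

theorem hsEnt_le_pauliForm (n : ℕ) (f : Matrix (Fin n → Fin 2) (Fin n → Fin 2) ℂ)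
    (hf : f.IsHermitian) :
    hsEnt f + hsSq f * Real.log (2 ^ n) ≤ 2 * pauliForm (κ := Fin n) pauliAt f := by
  induction n with
  | zero =>
    obtain ⟨U, c, hU, -, h⟩ := hf.exists_conj_diagonal
    have h1 : hsEnt f = 0 := by
      rw [hsEnt, h, trFun_conj_diagonal _ hU, hsSq_conj_diagonal hU, Fintype.sum_unique,
        Fintype.sum_unique, sub_self]
    rw [h1]
    simp [pauliForm]
  | succ n ih =>
    set e := consSumEquiv n
    obtain ⟨X, Y, Y', W, hg⟩ : ∃ X Y Y' W, f.submatrix e e = fromBlocks X Y Y' W :=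
      ⟨_, _, _, _, (fromBlocks_toBlocks _).symm⟩
    have hgH : (f.submatrix e e)ᴴ = f.submatrix e e := by rw [conjTranspose_submatrix, hf.eq]
    rw [hg, fromBlocks_conjTranspose] at hgH
    obtain ⟨hX, -, hY, hW⟩ := fromBlocks_inj.1 hgH
    subst hY
    have h := hsEnt_fromBlocks_le (σ := pauliAt (n := n)) pauliAt_conjTranspose
      (N := 2 ^ n) (by positivity) ih (Y := Y) hX hW
    rw [← hsEnt_submatrix_equiv e, ← hsSq_submatrix_equiv e, ← pauliForm_submatrix_equiv e, hg,
      pauliForm_fromBlocks, hsSq_conjTranspose, pow_succ']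
    linarith

lemma mEnt_mul_self {α : Type*} [Fintype α] [DecidableEq α] [Nonempty α] {f : Matrix α α ℂ}
    (hf : f.IsHermitian) :
    mEnt (f * f) =
      (hsEnt f + hsSq f * Real.log (Fintype.card α)) / Fintype.card α := by
  have hff : (f * f).IsHermitian := by
    rw [Matrix.IsHermitian, conjTranspose_mul, hf.eq]
  have hd : (Fintype.card α : ℝ) ≠ 0 := Nat.cast_ne_zero.2 Fintype.card_ne_zero
  have ht : (f * f).trace.re = hsSq f := by rw [hsSq, hf.eq]
  rw [mEnt, ntrace, ntrace, re_trace_hermFC _ hff, trFun_mul_self _ hf, ht, hsEnt]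
  rcases eq_or_ne (hsSq f) 0 with h | h
  · rw [h]
    simp
  · rw [Real.log_div h hd]
    ring

lemma dirichlet_pauliAt {n : ℕ} {f : Matrix (Fin n → Fin 2) (Fin n → Fin 2) ℂ}
    (hf : f.IsHermitian) :
    dirichlet (fun f => ∑ k : Fin n,
      (f - (1/4 : ℂ) • ∑ a : Fin 4, pauliAt k a * f * pauliAt k a)) f f =
      pauliForm (κ := Fin n) pauliAt f / Fintype.card (Fin n → Fin 2) := by
  rw [dirichlet, ntrace]
  congr 1
  simp only [pauliForm, hsSq, hf.eq, Finset.mul_sum, mul_sub, trace_sum, trace_sub, Complex.re_sum,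
    Complex.sub_re, mul_smul_comm, trace_smul, smul_eq_mul]
  refine Finset.sum_congr rfl fun k _ => ?_
  congr 1
  rw [show (1 / 4 : ℂ) = ((1 / 4 : ℝ) : ℂ) by norm_num]
  simp only [Complex.re_ofReal_mul, mul_assoc]

/-- 2-log-Sobolev inequality (with constant α = 2) for the generator of
tensor products of qubit depolarizing semigroups, `L = Σ_k L_k` with
`L_k(f) = f − (1/4) Σ_{a=0}^3 σ_k^a f σ_k^a`. -/
theorem depolarizing_two_log_sobolev
    (n : ℕ) (hn : 1 ≤ n)
    (L : Matrix (Fin n → Fin 2) (Fin n → Fin 2) ℂ →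
      Matrix (Fin n → Fin 2) (Fin n → Fin 2) ℂ)
    (hL : L = fun f => ∑ k : Fin n,
      (f - (1/4 : ℂ) • ∑ a : Fin 4, pauliAt k a * f * pauliAt k a))
    (f : Matrix (Fin n → Fin 2) (Fin n → Fin 2) ℂ) (hf : f.PosSemidef) :
    mEnt (f * f) ≤ 2 * dirichlet L f f := by
  have h := hsEnt_le_pauliForm n f hf.isHermitian
  have hc : (Fintype.card (Fin n → Fin 2) : ℝ) = 2 ^ n := by simp
  rw [hL, dirichlet_pauliAt hf.isHermitian, mEnt_mul_self hf.isHermitian, ← mul_div_assoc, hc]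
  exact div_le_div_of_nonneg_right h (by positivity)
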